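/- Let π ∈ ℤ[i] be a primary prime with p = π·π̄ and let χ̃_π be the associated Hecke character of weight one. If p ≡ 5 (mod 8), then L(1, χ̃_π) ≠ 0. -/

import Mathlib

open Complex BigOperators

noncomputable section

/-- The ring of Gaussian integers `ℤ[i]`, realized as a subring of `ℂ`. -/
def O4 : Subring ℂ := Subring.closure {Complex.I}

/-- `ζ₈ = e^{2πi/8}`, a primitive eighth root of unity. -/
def zeta8 : ℂ := Complex.exp (2 * Real.pi * Complex.I / 8)

/-- The ring `ℤ[ζ₈]`, realized as a subring of `ℂ`. -/
def O8 : Subring ℂ := Subring.closure {zeta8}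

/-- The congruence `a ≡ b (mod c)` in `ℤ[i]`. -/
def GCong (a b c : ℂ) : Prop := ∃ d ∈ O4, a - b = c * d

/-- `a` and `b` are coprime in `ℤ[i]`. -/
def GCoprime (a b : ℂ) : Prop := ∃ u ∈ O4, ∃ v ∈ O4, u * a + v * b = 1

/-- The real period `ϖ = 2∫₀¹ (1−x⁴)^{−1/2} dx`. -/
def varpi : ℝ := 2 * ∫ x in (0:ℝ)..(1:ℝ), (1 - x ^ 4) ^ (-(1:ℝ)/2)

/-- The points of the period lattice `ϖ·ℤ[i]`. -/
def ω4 (m : ℤ × ℤ) : ℂ := (varpi : ℂ) * ((m.1 : ℂ) + (m.2 : ℂ) * Complex.I)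

/-- The Weierstrass `℘`-function of the period lattice `ϖ·ℤ[i]`
(so that `℘′² = 4℘³ − 4℘`). -/
def wp4 (u : ℂ) : ℂ :=
  (u ^ 2)⁻¹ + ∑' m : ℤ × ℤ, if m = 0 then 0 else (((u - ω4 m) ^ 2)⁻¹ - ((ω4 m) ^ 2)⁻¹)

/-- The derivative `℘′` of the Weierstrass `℘`-function of `ϖ·ℤ[i]`. -/
def wp4' (u : ℂ) : ℂ := ∑' m : ℤ × ℤ, (-2) * ((u - ω4 m) ^ 3)⁻¹

/-- The Weierstrass `ζ`-function of the period lattice `ϖ·ℤ[i]`. -/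
def wzeta4 (u : ℂ) : ℂ :=
  u⁻¹ + ∑' m : ℤ × ℤ, if m = 0 then 0 else ((u - ω4 m)⁻¹ + (ω4 m)⁻¹ + u * ((ω4 m) ^ 2)⁻¹)

/-- The non-analytic doubly periodic function `Z(u) = ζ(ϖu) − (π/ϖ)·ū`. -/
def Z4 (u : ℂ) : ℂ :=
  wzeta4 ((varpi : ℂ) * u) - ((Real.pi / varpi : ℝ) : ℂ) * (starRingEnd ℂ) u

/-- The lemniscatic sine `φ(u) = sl((1−i)ϖu) = −2(1−i)·℘(ϖu)/℘′(ϖu)`,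
of period lattice `ℤ[i]`. -/
def phi4 (u : ℂ) : ℂ :=
  -2 * (1 - Complex.I) * wp4 ((varpi : ℂ) * u) / wp4' ((varpi : ℂ) * u)

/-- The lemniscatic cosine `ψ(u) = cl((1−i)ϖu) = (℘(ϖu)+i)/(℘(ϖu)−i)`,
of period lattice `ℤ[i]`. -/
def psi4 (u : ℂ) : ℂ :=
  (wp4 ((varpi : ℂ) * u) + Complex.I) / (wp4 ((varpi : ℂ) * u) - Complex.I)

/-- A residue class character modulo `β` on `ℤ[i]`. -/
structure IsResChar4 (β : ℂ) (χ : ℂ → ℂ) : Prop where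
  periodic : ∀ a ∈ O4, ∀ b ∈ O4, GCong a b β → χ a = χ b
  map_mul : ∀ a ∈ O4, ∀ b ∈ O4, χ (a * b) = χ a * χ b
  map_one : χ 1 = 1
  vanish : ∀ a ∈ O4, ¬ GCoprime a β → χ a = 0

/-- The quartic residue character `χ_π = (·/π)₄` modulo a prime `π` with `p = π·π̄`:
`χ_π(ν)⁴ = 1` and `χ_π(ν) ≡ ν^{(p−1)/4} (mod π)`. -/
structure IsQuarticChar (π : ℂ) (p : ℕ) (χ : ℂ → ℂ) : Prop where
  resChar : IsResChar4 π χ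
  quart : ∀ ν ∈ O4, GCoprime ν π → χ ν ^ 4 = 1
  euler : ∀ ν ∈ O4, GCoprime ν π → GCong (χ ν) (ν ^ ((p - 1) / 4)) π

/-- The elliptic Gauss sum `G_π(χ, f) = (1/4)·Σ_{ν ∈ (ℤ[i]/(π))^×} χ(ν)·f(ν/π)`,
computed via the integer representatives `1, …, p−1` of `(ℤ[i]/(π))^× ≅ (ℤ/p)^×`. -/
def EGS4 (p : ℕ) (χ f : ℂ → ℂ) (π : ℂ) : ℂ :=
  (1/4 : ℂ) * ∑ r ∈ Finset.Icc 1 (p - 1), χ (r : ℂ) * f ((r : ℂ) / π)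

/-- `S` is a quarter set of `(ℤ[i]/(π))^×`, i.e. `(ℤ[i]/(π))^× = S ∪ −S ∪ iS ∪ −iS`. -/
def IsQuarterSet (π : ℂ) (S : Finset ℂ) : Prop :=
  (∀ ν ∈ S, ν ∈ O4 ∧ GCoprime ν π) ∧
  (∀ a ∈ O4, GCoprime a π →
    ∃ ν ∈ S, ∃ ε ∈ ({1, -1, Complex.I, -Complex.I} : Set ℂ), GCong a (ε * ν) π) ∧
  (∀ ν ∈ S, ∀ μ ∈ S, ∀ ε ∈ ({1, -1, Complex.I, -Complex.I} : Set ℂ),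
    ∀ ε' ∈ ({1, -1, Complex.I, -Complex.I} : Set ℂ),
      GCong (ε * ν) (ε' * μ) π → ν = μ ∧ ε = ε')

/-- `γ(S)`: if `p ≡ 5 (mod 8)`, the fourth root of unity with
`γ(S) ≡ ∏_{ν∈S} ν (mod π)`; if `p ≡ 1 (mod 8)`, the fourth root of `−1` with
`γ(S) ≡ ∏_{ν∈S} ν (mod Π)` for a fixed prime `Π` of `ℤ[ζ₈]` with `π = Π·Π′`. -/
def IsGamma4 (π : ℂ) (p : ℕ) (S : Finset ℂ) (γ : ℂ) : Prop :=
  (p % 8 = 5 → γ ^ 4 = 1 ∧ GCong γ (∏ ν ∈ S, ν) π) ∧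
  (p % 8 = 1 → γ ^ 4 = -1 ∧
    ∃ P : O8, Prime P ∧ (∃ Q : O8, π = (P : ℂ) * (Q : ℂ)) ∧
      ∃ d ∈ O8, γ - ∏ ν ∈ S, ν = (P : ℂ) * d)

/-- `L` is the value at `s = 1` of the analytic continuation of the Hecke `L`-series
`L(s, χ̃) = Σ_𝔞 χ̃(𝔞)·N𝔞^{−s} = (1/4)·Σ_{ν ∈ ℤ[i]} χ₁(ν)·ν̄·|ν|^{−2s}` attached to the
weight-one Hecke character `χ̃((ν)) = χ₁(ν)·ν̄` of `ℚ(i)`. -/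
def IsLValue4 (χ₁ : ℂ → ℂ) (L : ℂ) : Prop :=
  ∃ F : ℂ → ℂ, DifferentiableOn ℂ F {s : ℂ | 0 < s.re} ∧
    (∀ s : ℂ, 3/2 < s.re →
      F s = (1/4 : ℂ) *
        ∑' ν : O4, χ₁ (ν : ℂ) * (starRingEnd ℂ) (ν : ℂ) *
          ((Complex.normSq (ν : ℂ) : ℂ) ^ (-s))) ∧
    F 1 = L

/-- `T` is a complete residue system modulo `β` in `ℤ[i]`. -/
def IsCRS4 (β : ℂ) (T : Finset ℂ) : Prop :=
  (∀ a ∈ T, a ∈ O4) ∧ (∀ a ∈ T, ∀ b ∈ T, GCong a b β → a = b) ∧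
  (∀ z ∈ O4, ∃ a ∈ T, GCong z a β)

/-- `e^{2πi·Re(z)}`. -/
def eRe4 (z : ℂ) : ℂ := Complex.exp (2 * Real.pi * Complex.I * (z.re : ℂ))

/-- `χ₀`: the character mod `(1+i)³` giving the natural isomorphism
`(ℤ[i]/(1+i)³)^× ≅ W`, i.e. `χ₀(ν) = ε` for `ν ≡ ε (mod (1+i)³)`, `ε ∈ W = {±1, ±i}`. -/
def IsChi0₄ (χ₀ : ℂ → ℂ) : Prop :=
  IsResChar4 ((1 + Complex.I) ^ 3) χ₀ ∧
    ∀ ε ∈ ({1, -1, Complex.I, -Complex.I} : Set ℂ), χ₀ ε = ε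

/-- `χ₀′`: the character mod `(1+i)² = 2i` giving `(ℤ[i]/(2))^× ≅ {±1}`, i.e.
`χ₀′(ν) = δ²` for `ν ≡ δ (mod (1+i)²)`, `δ ∈ {1, i}`. -/
def IsChi0'₄ (χ₀' : ℂ → ℂ) : Prop :=
  IsResChar4 2 χ₀' ∧ χ₀' Complex.I = -1

/-- The classical quartic Gauss sum `G₄(π) = Σ_{r=1}^{p−1} (r/π)₄·e^{2πir/p}`. -/
def G4sum (p : ℕ) (χ : ℂ → ℂ) : ℂ :=
  ∑ r ∈ Finset.Icc 1 (p - 1), χ (r : ℂ) * Complex.exp (2 * Real.pi * Complex.I * (r : ℂ) / (p : ℂ))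

namespace GaussHecke

open Filter Topology

/-- The parity sign `(-1)^(a+b)` of a Gaussian integer `a + bi`. -/
def sg (k : GaussianInt) : ℂ := (-1) ^ (k.re + k.im)

lemma sg_add (a b : GaussianInt) : sg (a + b) = sg a * sg b := by
  unfold sg
  rw [← zpow_add₀ (by norm_num)]
  congr 1
  simp only [Zsqrtd.re_add, Zsqrtd.im_add]
  ring

lemma sg_eq (a : GaussianInt) : sg a = 1 ∨ sg a = -1 := by
  unfold sg
  rcases Int.even_or_odd (a.re + a.im) with h | h
  · exact Or.inl h.neg_one_zpow
  · exact Or.inr h.neg_one_zpow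

lemma norm_sg (a : GaussianInt) : ‖sg a‖ = 1 := by
  rcases sg_eq a with h | h <;> simp [h]

lemma sg_sq (a : GaussianInt) : sg a * sg a = 1 := by
  rcases sg_eq a with h | h <;> simp [h]

/-- The imaginary unit of `ℤ[i]`. -/
def gI : GaussianInt := ⟨0, 1⟩

lemma coe_gI : (gI : ℂ) = Complex.I := by simp [gI, GaussianInt.toComplex_def]

lemma gI_mul_gI : gI * gI = -1 := by
  ext <;> simp [gI]

lemma sg_zero : sg 0 = 1 := by simp [sg]

lemma sg_one : sg 1 = -1 := by simp [sg]

lemma sg_gI : sg gI = -1 := by simp [sg, gI]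

lemma sg_neg (a : GaussianInt) : sg (-a) = sg a := by
  have h := sg_add a (-a)
  rw [add_neg_cancel, sg_zero] at h
  calc sg (-a) = (sg a * sg a) * sg (-a) := by rw [sg_sq, one_mul]
    _ = sg a := by rw [mul_assoc, ← h, mul_one]

lemma sg_gI_mul (a : GaussianInt) : sg (gI * a) = sg a := by
  unfold sg
  simp only [gI, Zsqrtd.re_mul, Zsqrtd.im_mul]
  rw [show (0 * a.re + -1 * 1 * a.im + (0 * a.im + 1 * a.re)) = (a.re + a.im) + 2 * (-a.im) by ring,
    zpow_add₀ (by norm_num), zpow_mul]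
  norm_num

lemma re_le (k : GaussianInt) : |(k.re : ℝ)| ≤ ‖(k : ℂ)‖ := by
  rw [GaussianInt.intCast_re]; exact Complex.abs_re_le_norm _

lemma im_le (k : GaussianInt) : |(k.im : ℝ)| ≤ ‖(k : ℂ)‖ := by
  rw [GaussianInt.intCast_im]; exact Complex.abs_im_le_norm _

/-- The coordinates of a Gaussian integer. -/
def coords (k : GaussianInt) : Fin 2 → ℤ := ![k.re, k.im]

lemma coords_injective : Function.Injective coords := by
  intro a b h
  have h0 := congrFun h 0
  have h1 := congrFun h 1
  simp only [coords, Matrix.cons_val_zero, Matrix.cons_val_one] at h0 h1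
  exact Zsqrtd.ext h0 h1

lemma norm_coords_le (k : GaussianInt) : ‖coords k‖ ≤ ‖(k : ℂ)‖ := by
  rw [pi_norm_le_iff_of_nonneg (norm_nonneg _)]
  intro j
  fin_cases j
  · simpa [coords, Int.norm_eq_abs] using re_le k
  · simpa [coords, Int.norm_eq_abs] using im_le k

lemma norm_coords_pos {k : GaussianInt} (hk : k ≠ 0) : 0 < ‖coords k‖ := by
  rw [norm_pos_iff]
  intro h
  apply hk
  apply coords_injective
  rw [h]
  ext j
  fin_cases j <;> simp [coords]

lemma finite_norm_le (R : ℝ) : {k : GaussianInt | ‖(k : ℂ)‖ ≤ R}.Finite := by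
  have h : (Metric.closedBall (0 : Fin 2 → ℤ) R).Finite :=
    (isCompact_closedBall _ _).finite_of_discrete
  refine (h.preimage coords_injective.injOn).subset ?_
  intro k hk
  simp only [Set.mem_preimage, Metric.mem_closedBall, dist_zero_right]
  exact (norm_coords_le k).trans hk

lemma eventually_norm_gt (R : ℝ) : ∀ᶠ k : GaussianInt in cofinite, R < ‖(k : ℂ)‖ := by
  have := finite_norm_le R
  rw [Filter.eventually_cofinite]
  simpa only [not_lt] using this

lemma summable_norm_rpow {r : ℝ} (hr : 2 < r) :
    Summable fun k : GaussianInt => ‖(k : ℂ)‖ ^ (-r) := by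
  have h := (EisensteinSeries.summable_one_div_norm_rpow hr).comp_injective coords_injective
  refine Summable.of_norm_bounded_eventually h ?_
  filter_upwards [eventually_norm_gt 0] with k hk
  have hk0 : k ≠ 0 := by rintro rfl; simp at hk
  rw [Real.norm_of_nonneg (by positivity)]
  exact Real.rpow_le_rpow_of_nonpos (norm_coords_pos hk0) (norm_coords_le k) (by linarith)

lemma eventually_half_le (ρ : ℂ) : ∀ᶠ k : GaussianInt in cofinite, ‖(k : ℂ)‖ / 2 ≤ ‖ρ + k‖ := by
  filter_upwards [eventually_norm_gt (2 * ‖ρ‖)] with k hk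
  have := norm_sub_norm_le (k : ℂ) (-ρ)
  rw [norm_neg, sub_neg_eq_add, add_comm _ ρ] at this
  linarith

lemma summable_shift_rpow (ρ : ℂ) {r : ℝ} (hr : 2 < r) :
    Summable fun k : GaussianInt => ‖ρ + (k : ℂ)‖ ^ (-r) := by
  refine Summable.of_norm_bounded_eventually ((summable_norm_rpow hr).mul_left (2 ^ r)) ?_
  filter_upwards [eventually_norm_gt 0, eventually_half_le ρ] with k hk hk'
  rw [Real.norm_of_nonneg (by positivity)]
  calc ‖ρ + (k : ℂ)‖ ^ (-r) ≤ (‖(k : ℂ)‖ / 2) ^ (-r) :=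
        Real.rpow_le_rpow_of_nonpos (by positivity) hk' (by linarith)
    _ = 2 ^ r * ‖(k : ℂ)‖ ^ (-r) := by
        rw [Real.div_rpow hk.le (by norm_num), Real.rpow_neg (by norm_num : (0:ℝ) ≤ 2)]
        field_simp

/-- The discrete Laplacian with step `β` over the four unit directions. -/
def lap (f : ℂ → ℂ) (β z : ℂ) : ℂ :=
  4 * f z - f (z + β) - f (z - β) - f (z + Complex.I * β) - f (z - Complex.I * β)

lemma lap_inv_eq {z : ℂ} (hz : 2 ≤ ‖z‖) : lap (·⁻¹) 1 z = -4 / (z * (z ^ 4 - 1)) := by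
  have h0 : z ≠ 0 := by rintro rfl; simp at hz; linarith
  have key : ∀ w : ℂ, ‖w‖ = 1 → z + w ≠ 0 := by
    intro w hw h
    rw [eq_neg_of_add_eq_zero_left h, norm_neg, hw] at hz
    norm_num at hz
  have h1 : z + 1 ≠ 0 := key 1 (by simp)
  have h2 : z - 1 ≠ 0 := by simpa [sub_eq_add_neg] using key (-1) (by simp)
  have h3 : z + Complex.I ≠ 0 := key Complex.I (by simp)
  have h4 : z - Complex.I ≠ 0 := by simpa [sub_eq_add_neg] using key (-Complex.I) (by simp)
  have h5 : z ^ 4 - 1 = (z + 1) * (z - 1) * ((z + Complex.I) * (z - Complex.I)) := by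
    linear_combination (z ^ 2 - 1) * Complex.I_sq
  have h6 : z ^ 4 - 1 ≠ 0 := by
    rw [h5]; exact mul_ne_zero (mul_ne_zero h1 h2) (mul_ne_zero h3 h4)
  have h7 : (z + 1)⁻¹ + (z - 1)⁻¹ = 2 * z / (z ^ 2 - 1) := by
    have : z ^ 2 - 1 ≠ 0 := by
      rw [show z ^ 2 - 1 = (z + 1) * (z - 1) by ring]; exact mul_ne_zero h1 h2
    field_simp
    ring
  have h8 : (z + Complex.I)⁻¹ + (z - Complex.I)⁻¹ = 2 * z / (z ^ 2 + 1) := by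
    have h9 : z ^ 2 + 1 = (z + Complex.I) * (z - Complex.I) := by
      linear_combination Complex.I_sq
    rw [h9]
    field_simp
    ring
  have h9 : z ^ 2 - 1 ≠ 0 := by
    rw [show z ^ 2 - 1 = (z + 1) * (z - 1) by ring]; exact mul_ne_zero h1 h2
  have h10 : z ^ 2 + 1 ≠ 0 := by
    rw [show z ^ 2 + 1 = (z + Complex.I) * (z - Complex.I) by linear_combination Complex.I_sq]
    exact mul_ne_zero h3 h4
  calc lap (·⁻¹) 1 z = 4 * z⁻¹ - ((z + 1)⁻¹ + (z - 1)⁻¹)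
        - ((z + Complex.I)⁻¹ + (z - Complex.I)⁻¹) := by simp only [lap, mul_one]; ring
    _ = 4 * z⁻¹ - 2 * z / (z ^ 2 - 1) - 2 * z / (z ^ 2 + 1) := by rw [h7, h8]
    _ = -4 / (z * ((z ^ 2 - 1) * (z ^ 2 + 1))) := by
        field_simp
        ring
    _ = _ := by rw [show (z ^ 2 - 1) * (z ^ 2 + 1) = z ^ 4 - 1 by ring]

lemma norm_lap_inv_le {z : ℂ} (hz : 2 ≤ ‖z‖) : ‖lap (·⁻¹) 1 z‖ ≤ 4 * ‖z‖ ^ (-3 : ℝ) := by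
  rw [lap_inv_eq hz, norm_div, norm_neg, norm_mul]
  have h1 : ‖z‖ ^ 2 ≤ ‖z ^ 4 - 1‖ := by
    have := norm_sub_norm_le (z ^ 4) 1
    rw [norm_pow, norm_one] at this
    nlinarith [sq_nonneg (‖z‖ ^ 2 - 2), mul_self_le_mul_self (by norm_num) hz]
  have h2 : ‖z‖ ^ (-3 : ℝ) = (‖z‖ ^ 3)⁻¹ := by
    rw [Real.rpow_neg (norm_nonneg _)]
    norm_cast
  rw [h2, div_eq_mul_inv]
  have h3 : (0:ℝ) < ‖z‖ := by linarith
  have h4 : ‖(4:ℂ)‖ = 4 := by simp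
  rw [h4]
  gcongr
  calc ‖z‖ ^ 3 = ‖z‖ * ‖z‖ ^ 2 := by ring
    _ ≤ _ := by gcongr

/-- The elliptic function `∑ₖ (-1)ᵏ / (u + k)` over the Gaussian integers, summed after
smoothing by the discrete Laplacian. -/
def ellE (u : ℂ) : ℂ := (1 / 8) * ∑' k : GaussianInt, sg k * lap (·⁻¹) 1 (u + k)

/-- The function `z ↦ 1 / (u + z)` with the value at a pole `z = -a` replaced by `0`. -/
def regInv (a u z : ℂ) : ℂ := if a + z = 0 then 0 else (u + z)⁻¹

/-- The part of `ellE` regular at `a`. -/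
def regE (a u : ℂ) : ℂ := (1 / 8) * ∑' k : GaussianInt, sg k * lap (regInv a u) 1 k

lemma lap_regInv_eq {a u k : ℂ} (hk : 3 ≤ ‖a + k‖) :
    lap (regInv a u) 1 k = lap (·⁻¹) 1 (u + k) := by
  have key : ∀ w : ℂ, ‖w‖ ≤ 1 → regInv a u (k + w) = ((u + k) + w)⁻¹ := by
    intro w hw
    have : a + (k + w) ≠ 0 := by
      intro h
      have h2 : a + k = -w := by linear_combination h
      rw [h2, norm_neg] at hk
      linarith
    rw [regInv, if_neg this, add_assoc]
  have h0 := key 0 (by simp)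
  have h1 := key 1 (by simp)
  have h2 := key (-1) (by simp)
  have h3 := key Complex.I (by simp)
  have h4 := key (-Complex.I) (by simp)
  simp only [lap, mul_one]
  simp only [add_zero] at h0
  rw [h0, h1, h3, sub_eq_add_neg k 1, h2, sub_eq_add_neg k Complex.I, h4]
  simp only [sub_eq_add_neg]

lemma norm_term_le {a u : ℂ} {k : GaussianInt} (hu : u ∈ Metric.ball a (1 / 2))
    (hk : 3 ≤ ‖a + k‖) :
    ‖sg k * lap (regInv a u) 1 k‖ ≤ 32 * ‖a + (k : ℂ)‖ ^ (-3 : ℝ) := by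
  rw [lap_regInv_eq hk, norm_mul, norm_sg, one_mul]
  have h1 : ‖a + (k : ℂ)‖ - 1 / 2 ≤ ‖u + k‖ := by
    have h2 := norm_sub_norm_le (a + (k : ℂ)) (u + k)
    rw [add_sub_add_right_eq_sub] at h2
    rw [Metric.mem_ball, dist_comm, dist_eq_norm] at hu
    linarith
  refine (norm_lap_inv_le (by linarith)).trans ?_
  have h3 : ‖u + (k : ℂ)‖ ^ (-3 : ℝ) ≤ (‖a + (k : ℂ)‖ / 2) ^ (-3 : ℝ) :=
    Real.rpow_le_rpow_of_nonpos (by linarith) (by linarith) (by norm_num)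
  have h4 : (‖a + (k : ℂ)‖ / 2) ^ (-3 : ℝ) = 8 * ‖a + (k : ℂ)‖ ^ (-3 : ℝ) := by
    rw [Real.div_rpow (norm_nonneg _) (by norm_num)]
    rw [show (2:ℝ) ^ (-3:ℝ) = 1 / 8 by
      rw [Real.rpow_neg (by norm_num)]; norm_num]
    ring
  linarith

lemma finite_shift_lt (a : ℂ) : {k : GaussianInt | ¬ 3 ≤ ‖a + (k : ℂ)‖}.Finite := by
  refine (finite_norm_le (3 + ‖a‖)).subset ?_
  intro k hk
  simp only [Set.mem_ofPred_eq, not_le] at hk ⊢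
  have := norm_sub_le (a + (k : ℂ)) a
  rw [add_sub_cancel_left] at this
  linarith

lemma summable_regE {a u : ℂ} (hu : u ∈ Metric.ball a (1 / 2)) :
    Summable fun k : GaussianInt => sg k * lap (regInv a u) 1 k := by
  refine Summable.of_norm_bounded_eventually
    ((summable_shift_rpow a (r := 3) (by norm_num)).mul_left 32) ?_
  rw [Filter.eventually_cofinite]
  refine (finite_shift_lt a).subset ?_
  intro k hk h
  exact hk (norm_term_le hu h)

lemma analyticAt_regInv (a z : ℂ) : AnalyticAt ℂ (fun u => regInv a u z) a := by
  unfold regInv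
  by_cases h : a + z = 0
  · simp only [h, if_true]
    exact analyticAt_const
  · simp only [h, if_false]
    exact (analyticAt_id.add analyticAt_const).inv h

lemma analyticAt_regE (a : ℂ) : AnalyticAt ℂ (regE a) a := by
  set S := (finite_shift_lt a).toFinset with hS
  have hsplit : ∀ᶠ u in 𝓝 a, regE a u = (1 / 8) * (∑ k ∈ S, sg k * lap (regInv a u) 1 k +
      ∑' k : {k // k ∉ S}, sg (k : GaussianInt) * lap (regInv a u) 1 (k : GaussianInt)) := by
    filter_upwards [Metric.ball_mem_nhds a (by norm_num : (0:ℝ) < 1 / 2)] with u hu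
    rw [regE, (summable_regE hu).sum_add_tsum_subtype_compl]
  refine AnalyticAt.congr ?_ (hsplit.mono fun _ h => h.symm)
  refine analyticAt_const.mul (AnalyticAt.add ?_ ?_)
  · refine Finset.analyticAt_fun_sum _ fun k _ => analyticAt_const.mul ?_
    unfold lap
    exact ((((analyticAt_const.mul (analyticAt_regInv _ _)).sub (analyticAt_regInv _ _)).sub
      (analyticAt_regInv _ _)).sub (analyticAt_regInv _ _)).sub (analyticAt_regInv _ _)
  · have hd : DifferentiableOn ℂ (fun u => ∑' k : {k // k ∉ S},
        sg (k : GaussianInt) * lap (regInv a u) 1 (k : GaussianInt)) (Metric.ball a (1 / 2)) := by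
      refine differentiableOn_tsum_of_summable_norm
        (u := fun k : {k // k ∉ S} => 32 * ‖a + ((k : GaussianInt) : ℂ)‖ ^ (-3 : ℝ)) ?_ ?_
        Metric.isOpen_ball ?_
      · exact ((summable_shift_rpow a (r := 3) (by norm_num)).mul_left 32).comp_injective
          Subtype.val_injective
      · rintro ⟨k, hk⟩ u hu
        have hk3 : 3 ≤ ‖a + (k : ℂ)‖ := by
          by_contra h
          exact hk (by simpa [hS] using h)
        have hne : ∀ w : ℂ, ‖w‖ ≤ 1 → u + (k + w) ≠ 0 := by
          intro w hw h
          have h2 : a + (k : ℂ) = (a - u) - w := by linear_combination h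
          have h3 := norm_sub_le (a - u) w
          rw [← h2] at h3
          rw [Metric.mem_ball, dist_comm, dist_eq_norm] at hu
          linarith
        have hdiff : ∀ w : ℂ, ‖w‖ ≤ 1 →
            DifferentiableWithinAt ℂ (fun u => regInv a u (k + w)) (Metric.ball a (1 / 2)) u := by
          intro w hw
          unfold regInv
          split_ifs
          · exact differentiableWithinAt_const _
          · have h1 : DifferentiableAt ℂ (fun u => u + ((k : ℂ) + w)) u :=
              differentiableAt_id.add_const _
            exact (h1.fun_inv (hne w hw)).differentiableWithinAt
        have h0 := hdiff 0 (by simp)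
        have h1 := hdiff 1 (by simp)
        have h2 := hdiff (-1) (by simp)
        have h3 := hdiff Complex.I (by simp)
        have h4 := hdiff (-Complex.I) (by simp)
        simp only [add_zero, ← sub_eq_add_neg] at h0 h1 h2 h3 h4
        unfold lap
        simp only [mul_one]
        exact (((((h0.const_mul 4).sub h1).sub h2).sub h3).sub h4).const_mul _
      · rintro ⟨k, hk⟩ u hu
        refine norm_term_le hu ?_
        by_contra h
        exact hk (by simpa [hS] using h)
    exact hd.analyticAt (Metric.ball_mem_nhds a (by norm_num))

lemma ellE_eq_regE {a : ℂ} (ha : ∀ k : GaussianInt, a + k ≠ 0) (u : ℂ) : ellE u = regE a u := by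
  unfold ellE regE
  congr 2
  ext k
  congr 1
  have key : ∀ w : GaussianInt, regInv a u (k + w) = ((u + k) + w)⁻¹ := by
    intro w
    have := ha (k + w)
    rw [GaussianInt.toComplex_add] at this
    rw [regInv, if_neg this, add_assoc]
  have h0 := key 0
  have h1 := key 1
  have h2 := key (-1)
  have h3 := key gI
  have h4 := key (-gI)
  simp only [GaussianInt.toComplex_neg, GaussianInt.toComplex_one, GaussianInt.toComplex_zero,
    coe_gI, add_zero, ← sub_eq_add_neg] at h0 h1 h2 h3 h4
  simp only [lap, mul_one, h0, h1, h2, h3, h4]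

lemma analyticAt_ellE {a : ℂ} (ha : ∀ k : GaussianInt, a + k ≠ 0) : AnalyticAt ℂ ellE a := by
  have : ellE = regE a := funext (ellE_eq_regE ha)
  rw [this]
  exact analyticAt_regE a

lemma hasSum_delta (c : ℂ) (a : GaussianInt) :
    HasSum (fun k : GaussianInt => sg k * (if (k : ℂ) + a = 0 then c else 0)) (sg a * c) := by
  have h := hasSum_single (f := fun k : GaussianInt => sg k * (if (k : ℂ) + a = 0 then c else 0))
    (-a) (by
      intro b hb
      rw [if_neg, mul_zero]
      rw [← GaussianInt.toComplex_add, GaussianInt.toComplex_eq_zero]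
      intro h
      exact hb (eq_neg_of_add_eq_zero_left h))
  simpa [sg_neg] using h

lemma ellE_eq_inv_add {u : ℂ} (hu : u ∈ Metric.ball (0 : ℂ) (1 / 2)) :
    ellE u = u⁻¹ + regE 0 u := by
  have hs := (summable_regE hu).hasSum
  have hd := (((((hasSum_delta u⁻¹ 0).mul_left 4).sub (hasSum_delta u⁻¹ 1)).sub
    (hasSum_delta u⁻¹ (-1))).sub (hasSum_delta u⁻¹ gI)).sub (hasSum_delta u⁻¹ (-gI))
  have hsum := hs.add hd
  have hterm : (fun k : GaussianInt => sg k * lap (regInv 0 u) 1 k + (4 * (sg k *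
      (if (k : ℂ) + ((0 : GaussianInt) : ℂ) = 0 then u⁻¹ else 0)) -
      sg k * (if (k : ℂ) + ((1 : GaussianInt) : ℂ) = 0 then u⁻¹ else 0) -
      sg k * (if (k : ℂ) + ((-1 : GaussianInt) : ℂ) = 0 then u⁻¹ else 0) -
      sg k * (if (k : ℂ) + ((gI : GaussianInt) : ℂ) = 0 then u⁻¹ else 0) -
      sg k * (if (k : ℂ) + ((-gI : GaussianInt) : ℂ) = 0 then u⁻¹ else 0))) =
      fun k : GaussianInt => sg k * lap (·⁻¹) 1 (u + k) := by
    ext k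
    have key : ∀ z : ℂ, regInv 0 u z + (if z = 0 then u⁻¹ else 0) = (u + z)⁻¹ := by
      intro z
      unfold regInv
      by_cases h : z = 0 <;> simp [h]
    have h0 := key k
    have h1 := key (k + 1)
    have h2 := key (k - 1)
    have h3 := key (k + Complex.I)
    have h4 := key (k - Complex.I)
    simp only [GaussianInt.toComplex_neg, GaussianInt.toComplex_one, GaussianInt.toComplex_zero,
      coe_gI, add_zero, ← sub_eq_add_neg]
    simp only [lap, mul_one]
    rw [show u + (k : ℂ) + 1 = u + (k + 1) by ring, show u + (k : ℂ) - 1 = u + (k - 1) by ring,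
      show u + (k : ℂ) + Complex.I = u + (k + Complex.I) by ring,
      show u + (k : ℂ) - Complex.I = u + (k - Complex.I) by ring, ← h0, ← h1, ← h2, ← h3, ← h4]
    ring
  rw [hterm] at hsum
  rw [ellE, hsum.tsum_eq, regE, sg_zero, sg_one, sg_neg, sg_neg, sg_one, sg_gI]
  ring

lemma ellE_add (u : ℂ) (k : GaussianInt) : ellE (u + k) = sg k * ellE u := by
  unfold ellE
  rw [← (Equiv.subRight k).tsum_eq, mul_left_comm (sg k), ← tsum_mul_left (a := sg k)]
  refine congrArg _ (tsum_congr fun j => ?_)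
  simp only [Equiv.subRight_apply, GaussianInt.toComplex_sub]
  rw [show u + (k : ℂ) + (j - k) = u + j by ring, sub_eq_add_neg, sg_add, sg_neg]
  ring

lemma ellE_I_mul (u : ℂ) : ellE (Complex.I * u) = -Complex.I * ellE u := by
  have hinj : Function.Bijective (fun k : GaussianInt => gI * k) := by
    refine Function.bijective_iff_has_inverse.mpr ⟨fun k => -gI * k, fun k => ?_, fun k => ?_⟩ <;>
    · show _ * (_ * _) = _
      rw [← mul_assoc]
      simp [gI_mul_gI]
  unfold ellE
  rw [← (Equiv.ofBijective _ hinj).tsum_eq, mul_left_comm (-Complex.I),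
    ← tsum_mul_left (a := -Complex.I)]
  refine congrArg _ (tsum_congr fun k => ?_)
  simp only [Equiv.ofBijective_apply, GaussianInt.toComplex_mul, coe_gI, sg_gI_mul]
  simp only [lap, mul_one]
  set z := u + (k : ℂ)
  have hI : (Complex.I)⁻¹ = -Complex.I := Complex.inv_I
  have h0 : Complex.I * u + Complex.I * k = Complex.I * z := by simp only [z]; ring
  have h1 : Complex.I * z + 1 = Complex.I * (z - Complex.I) := by
    linear_combination Complex.I_sq
  have h2 : Complex.I * z - 1 = Complex.I * (z + Complex.I) := by
    linear_combination -Complex.I_sq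
  have h3 : Complex.I * z + Complex.I = Complex.I * (z + 1) := by ring
  have h4 : Complex.I * z - Complex.I = Complex.I * (z - 1) := by ring
  rw [h0, h1, h2, h3, h4]
  simp only [mul_inv, hI]
  ring

lemma ellE_neg (u : ℂ) : ellE (-u) = -ellE u := by
  have : -u = Complex.I * (Complex.I * u) := by linear_combination (-u) * Complex.I_sq
  rw [this, ellE_I_mul, ellE_I_mul]
  linear_combination ellE u * Complex.I_sq

/-- `f` agrees with an analytic function on a punctured neighbourhood of `z`. -/
def RegularAt (f : ℂ → ℂ) (z : ℂ) : Prop := ∃ h : ℂ → ℂ, AnalyticAt ℂ h z ∧ f =ᶠ[𝓝[≠] z] h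

lemma RegularAt.translate {f : ℂ → ℂ} {z c : ℂ} (hf : ∀ w, f (w + c) = f w)
    (h : RegularAt f z) : RegularAt f (z + c) := by
  obtain ⟨g, hg, hfg⟩ := h
  have hz : z + c - c = z := add_sub_cancel_right z c
  refine ⟨fun w => g (w - c), ?_, ?_⟩
  · refine AnalyticAt.fun_comp (by rw [hz]; exact hg) (analyticAt_id.sub analyticAt_const)
  · have ht : Tendsto (fun w => w - c) (𝓝[≠] (z + c)) (𝓝[≠] z) := by
      refine tendsto_nhdsWithin_iff.mpr ⟨?_, ?_⟩
      · have : Tendsto (fun w => w - c) (𝓝 (z + c)) (𝓝 (z + c - c)) :=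
          (continuous_id.sub continuous_const).tendsto _
        rw [hz] at this
        exact this.mono_left nhdsWithin_le_nhds
      · filter_upwards [self_mem_nhdsWithin] with w hw h
        exact hw (by rw [Set.mem_singleton_iff] at h ⊢; rw [← h]; ring)
    filter_upwards [ht.eventually hfg] with w hw
    rw [← hw, ← hf (w - c), sub_add_cancel]

/-- Liouville's theorem for functions periodic under `ℤ[i]` with removable singularities. -/
lemma exists_eq_const_of_regularAt {f : ℂ → ℂ} (hreg : ∀ z, RegularAt f z)
    (hper : ∀ z (k : GaussianInt), f (z + k) = f z) :
    ∃ c, ∀ z, ∀ᶠ w in 𝓝[≠] z, f w = c := by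
  choose h hh hfh using hreg
  have hlim : ∀ z, Tendsto f (𝓝[≠] z) (𝓝 (h z z)) := fun z =>
    ((hh z).continuousAt.tendsto.mono_left nhdsWithin_le_nhds).congr' (hfh z).symm
  have hF : ∀ z, (fun w => h w w) =ᶠ[𝓝 z] h z := by
    intro z
    have h1 : ∀ᶠ w in 𝓝[≠] z, f =ᶠ[𝓝 w] h z := by
      have := hfh z
      rw [EventuallyEq, eventually_nhdsWithin_iff] at this
      rw [eventually_nhdsWithin_iff]
      filter_upwards [this.eventually_nhds] with w hw hwz
      filter_upwards [hw, isOpen_compl_singleton.mem_nhds hwz] with v hv hvz using hv hvz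
    have h2 : ∀ᶠ w in 𝓝[≠] z, h w w = h z w := by
      filter_upwards [h1, (hh z).eventually_analyticAt.filter_mono nhdsWithin_le_nhds]
        with w hw hw'
      refine tendsto_nhds_unique (hlim w) ?_
      exact (hw'.continuousAt.tendsto.mono_left nhdsWithin_le_nhds).congr'
        (hw.filter_mono nhdsWithin_le_nhds).symm
    rw [eventually_nhdsWithin_iff] at h2
    filter_upwards [h2] with w hw
    by_cases hwz : w = z
    · rw [hwz]
    · exact hw hwz
  have hdiff : Differentiable ℂ (fun w => h w w) := fun z =>
    ((hh z).congr (hF z).symm).differentiableAt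
  have hFper : ∀ z (k : GaussianInt), h (z + k) (z + k) = h z z := by
    intro z k
    refine tendsto_nhds_unique (f := fun w => f (w + k)) (l := 𝓝[≠] z) ?_ ?_
    · refine (hlim (z + k)).comp (tendsto_nhdsWithin_iff.mpr ⟨?_, ?_⟩)
      · exact ((continuous_id.add continuous_const).tendsto z).mono_left nhdsWithin_le_nhds
      · filter_upwards [self_mem_nhdsWithin] with w hw h
        exact hw (add_right_cancel h)
    · simp only [hper]
      exact hlim z
  have hbdd : Bornology.IsBounded (Set.range fun w => h w w) := by
    refine (((isCompact_closedBall (0 : ℂ) 2).image hdiff.continuous).isBounded).subset ?_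
    rintro _ ⟨z, rfl⟩
    let k : GaussianInt := ⟨⌊z.re⌋, ⌊z.im⌋⟩
    refine ⟨z + ((-k : GaussianInt) : ℂ), ?_, hFper z (-k)⟩
    rw [mem_closedBall_zero_iff]
    refine (Complex.norm_le_abs_re_add_abs_im _).trans ?_
    have h1 : (z + ((-k : GaussianInt) : ℂ)).re = Int.fract z.re := by
      rw [Complex.add_re, ← GaussianInt.intCast_re]; simp [k, Int.fract, sub_eq_add_neg]
    have h2 : (z + ((-k : GaussianInt) : ℂ)).im = Int.fract z.im := by
      rw [Complex.add_im, ← GaussianInt.intCast_im]; simp [k, Int.fract, sub_eq_add_neg]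
    rw [h1, h2, abs_of_nonneg (Int.fract_nonneg _), abs_of_nonneg (Int.fract_nonneg _)]
    linarith [Int.fract_lt_one z.re, Int.fract_lt_one z.im]
  refine ⟨h 0 0, fun z => ?_⟩
  filter_upwards [hfh z, (hF z).filter_mono nhdsWithin_le_nhds] with w hw hw'
  rw [hw, ← hw']
  exact hdiff.apply_eq_apply_of_bounded hbdd w 0

/-- The point `1 / (1 + i)`. -/
def om : ℂ := (1 + Complex.I)⁻¹

lemma one_add_I_ne : (1 + Complex.I) ≠ 0 := by
  intro h
  have := congrArg Complex.re h
  simp at this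

lemma om_eq : om = (1 - Complex.I) / 2 := by
  rw [om, inv_eq_iff_eq_inv, inv_div, eq_div_iff]
  · linear_combination -Complex.I_sq
  · intro h
    have := congrArg Complex.re h
    simp at this

lemma one_add_I_mul_om : (1 + Complex.I) * om = 1 := mul_inv_cancel₀ one_add_I_ne

/-- Points that are not Gaussian integers. -/
def NonInt (u : ℂ) : Prop := ∀ k : GaussianInt, u + k ≠ 0

lemma nonInt_om : NonInt om := by
  intro k hk
  have := congrArg Complex.re hk
  rw [om_eq, Complex.add_re, ← GaussianInt.intCast_re, Complex.div_ofNat_re] at this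
  simp only [Complex.sub_re, Complex.one_re, Complex.I_re, sub_zero, Complex.zero_re] at this
  have h2 : ((1 + 2 * k.re : ℤ) : ℝ) = 0 := by push_cast; linarith
  norm_cast at h2
  omega

lemma coe_one_sub_gI : ((1 - gI : GaussianInt) : ℂ) = 1 - Complex.I := by
  rw [GaussianInt.toComplex_sub, GaussianInt.toComplex_one, coe_gI]

lemma sg_one_sub_gI : sg (1 - gI) = 1 := by simp [sg, gI]

lemma ellE_om_add_om (u : ℂ) : ellE (u + om + om) = ellE u := by
  have : u + om + om = u + ((1 - gI : GaussianInt) : ℂ) := by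
    rw [coe_one_sub_gI, om_eq]; ring
  rw [this, ellE_add, sg_one_sub_gI, one_mul]

lemma ellE_om : ellE om = 0 := by
  have h1 := ellE_om_add_om (-om)
  rw [neg_add_cancel, zero_add, ellE_neg] at h1
  exact CharZero.eq_neg_self_iff.mp h1

lemma exists_ellE_near_zero :
    ∃ d : ℂ → ℂ, AnalyticAt ℂ d 0 ∧ ∀ᶠ w in 𝓝 (0 : ℂ), ellE w = w⁻¹ + w * d w := by
  have h0 : regE 0 0 = 0 := by
    have h1 := ellE_eq_inv_add (u := 0) (by simp)
    have h2 := ellE_neg 0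
    rw [neg_zero] at h2
    rw [CharZero.eq_neg_self_iff.mp h2, inv_zero, zero_add] at h1
    exact h1.symm
  obtain ⟨p, hp⟩ := analyticAt_regE 0
  refine ⟨dslope (regE 0) 0, ⟨_, hp.has_fpower_series_dslope_fslope⟩, ?_⟩
  filter_upwards [Metric.ball_mem_nhds (0 : ℂ) (by norm_num : (0:ℝ) < 1 / 2)] with w hw
  rw [ellE_eq_inv_add hw]
  have := sub_smul_dslope (regE 0) 0 w
  rw [h0, sub_zero, sub_zero, smul_eq_mul] at this
  rw [this]

lemma exists_ellE_near_om :
    ∃ d : ℂ → ℂ, AnalyticAt ℂ d 0 ∧ ∀ w : ℂ, ellE (w + om) = w * d w := by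
  have han : AnalyticAt ℂ (fun w => ellE (w + om)) 0 := by
    refine AnalyticAt.fun_comp ?_ (analyticAt_id.add analyticAt_const)
    simpa using analyticAt_ellE nonInt_om
  obtain ⟨p, hp⟩ := han
  refine ⟨dslope (fun w => ellE (w + om)) 0, ⟨_, hp.has_fpower_series_dslope_fslope⟩,
    fun w => ?_⟩
  have := sub_smul_dslope (fun w => ellE (w + om)) 0 w
  simpa [ellE_om] using this.symm

lemma nonInt_cases (z : ℂ) : (∃ k : GaussianInt, z = 0 + k) ∨
    (∃ k : GaussianInt, z = 0 + k + om) ∨ (NonInt z ∧ NonInt (z + om)) := by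
  by_cases h1 : NonInt z
  · by_cases h2 : NonInt (z + om)
    · exact Or.inr (Or.inr ⟨h1, h2⟩)
    · right; left
      simp only [NonInt, not_forall, not_not] at h2
      obtain ⟨k, hk⟩ := h2
      refine ⟨-k - (1 - gI), ?_⟩
      rw [GaussianInt.toComplex_sub, coe_one_sub_gI, GaussianInt.toComplex_neg]
      rw [om_eq] at hk ⊢
      linear_combination hk
  · left
    simp only [NonInt, not_forall, not_not] at h1
    obtain ⟨k, hk⟩ := h1
    exact ⟨-k, by rw [GaussianInt.toComplex_neg]; linear_combination hk⟩

/-- To prove a function with periods `ℤ[i]` and `1 / (1 + i)` regular everywhere, it suffices to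
look at the origin and at the points outside these periods. -/
lemma regularAt_of_periods {f : ℂ → ℂ} (hper : ∀ z (k : GaussianInt), f (z + k) = f z)
    (hom : ∀ z, f (z + om) = f z) (h0 : RegularAt f 0)
    (h1 : ∀ z, NonInt z → NonInt (z + om) → RegularAt f z) (z : ℂ) : RegularAt f z := by
  rcases nonInt_cases z with ⟨k, rfl⟩ | ⟨k, rfl⟩ | ⟨ha, hb⟩
  · exact h0.translate (fun w => hper w k)
  · exact (h0.translate (fun w => hper w k)).translate hom
  · exact h1 z ha hb

lemma AnalyticAt.regularAt {f : ℂ → ℂ} {z : ℂ} (h : AnalyticAt ℂ f z) : RegularAt f z :=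
  ⟨f, h, EventuallyEq.rfl⟩

lemma eq_of_eventually_const {f : ℂ → ℂ} {c z : ℂ} (hf : AnalyticAt ℂ f z)
    (h : ∀ᶠ w in 𝓝[≠] z, f w = c) : f z = c :=
  tendsto_nhds_unique (hf.continuousAt.tendsto.mono_left nhdsWithin_le_nhds)
    (tendsto_const_nhds.congr' (h.mono fun _ hw => hw.symm))

lemma analyticAt_ellE_add_om {z : ℂ} (h : NonInt (z + om)) :
    AnalyticAt ℂ (fun w => ellE (w + om)) z :=
  AnalyticAt.fun_comp (analyticAt_ellE h) (analyticAt_id.add analyticAt_const)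

lemma ellE_eventually_ne_zero : ∀ᶠ w in 𝓝[≠] (0 : ℂ), ellE w ≠ 0 := by
  obtain ⟨d, hd, he⟩ := exists_ellE_near_zero
  have hc : ContinuousAt (fun w => 1 + w ^ 2 * d w) 0 :=
    continuousAt_const.add ((continuousAt_id.pow 2).mul hd.continuousAt)
  have h1 : ∀ᶠ w in 𝓝 (0 : ℂ), 1 + w ^ 2 * d w ≠ 0 := hc.eventually_ne (by simp)
  rw [eventually_nhdsWithin_iff]
  filter_upwards [he, h1] with w hw hw1 hw0 h
  apply hw1
  have hw0' : w ≠ 0 := hw0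
  calc 1 + w ^ 2 * d w = w * (w⁻¹ + w * d w) := by field_simp
    _ = 0 := by rw [← hw, h, mul_zero]

lemma isPreconnected_nonInt : IsPreconnected {u : ℂ | NonInt u} := by
  have hcount : (Set.range fun k : GaussianInt => -(k : ℂ)).Countable := by
    have : Countable GaussianInt := coords_injective.countable
    exact Set.countable_range _
  have hset : {u : ℂ | NonInt u} = (Set.range fun k : GaussianInt => -(k : ℂ))ᶜ := by
    ext u
    simp only [NonInt, Set.mem_compl_iff, Set.mem_range, not_exists]
    refine forall_congr' fun k => not_congr ⟨fun h => ?_, fun h => ?_⟩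
    · linear_combination -h
    · rw [← h]; ring
  rw [hset]
  exact (hcount.isPathConnected_compl_of_one_lt_rank
    (by rw [Complex.rank_real_complex]; norm_num)).isConnected.isPreconnected

theorem exists_ellE_mul_shift : ∃ K : ℂ, K ≠ 0 ∧
    ∀ u, NonInt u → NonInt (u + om) → ellE u * ellE (u + om) = K := by
  have hper : ∀ z (k : GaussianInt),
      ellE (z + k) * ellE (z + k + om) = ellE z * ellE (z + om) := by
    intro z k
    rw [add_right_comm, ellE_add, ellE_add]
    linear_combination ellE z * ellE (z + om) * sg_sq k
  have hom : ∀ z, ellE (z + om) * ellE (z + om + om) = ellE z * ellE (z + om) := by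
    intro z
    rw [ellE_om_add_om, mul_comm]
  have han : ∀ z, NonInt z → NonInt (z + om) →
      AnalyticAt ℂ (fun u => ellE u * ellE (u + om)) z := fun z h1 h2 =>
    (analyticAt_ellE h1).mul (analyticAt_ellE_add_om h2)
  obtain ⟨K, hK⟩ := exists_eq_const_of_regularAt
    (regularAt_of_periods (f := fun u => ellE u * ellE (u + om)) hper hom
      (by
        obtain ⟨d, hd, he⟩ := exists_ellE_near_zero
        obtain ⟨d', hd', he'⟩ := exists_ellE_near_om
        refine ⟨fun w => d' w + w ^ 2 * (d w * d' w),
          hd'.add ((analyticAt_id.pow 2).mul (hd.mul hd')), ?_⟩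
        rw [EventuallyEq, eventually_nhdsWithin_iff]
        filter_upwards [he] with w hw hw0
        have hw0' : w ≠ 0 := hw0
        rw [hw, he']
        field_simp)
      (fun z h1 h2 => AnalyticAt.regularAt (han z h1 h2))) hper
  refine ⟨K, ?_, fun u h1 h2 => eq_of_eventually_const (f := fun u => ellE u * ellE (u + om))
    (han u h1 h2) (hK u)⟩
  rintro rfl
  have h1 : ∀ᶠ w in 𝓝[≠] (0 : ℂ), ellE (w + om) = 0 := by
    filter_upwards [hK 0, ellE_eventually_ne_zero] with w hw hw'
    exact (mul_eq_zero.mp hw).resolve_left hw'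
  have h2 : ∀ᶠ w in 𝓝 om, ellE w = 0 := by
    have h3 : ∀ᶠ w in 𝓝 (0 : ℂ), ellE (w + om) = 0 := by
      rw [eventually_nhdsWithin_iff] at h1
      filter_upwards [h1] with w hw
      by_cases h : w = 0
      · rw [h, zero_add, ellE_om]
      · exact hw h
    have ht : Tendsto (fun w => w - om) (𝓝 om) (𝓝 0) := by
      have : Tendsto (fun w => w - om) (𝓝 om) (𝓝 (om - om)) :=
        (continuous_id.sub continuous_const).tendsto _
      rwa [sub_self] at this
    filter_upwards [ht.eventually h3] with w hw
    rwa [sub_add_cancel] at hw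
  have h4 : Set.EqOn ellE 0 {u | NonInt u} :=
    AnalyticOnNhd.eqOn_zero_of_preconnected_of_eventuallyEq_zero
      (fun u hu => analyticAt_ellE hu) isPreconnected_nonInt nonInt_om h2
  have h5 : ∀ᶠ w in 𝓝[≠] (0 : ℂ), NonInt w := by
    rw [eventually_nhdsWithin_iff]
    filter_upwards [Metric.ball_mem_nhds (0 : ℂ) one_pos] with w hw hw0 k hk
    have hwk : w = ((-k : GaussianInt) : ℂ) := by
      rw [GaussianInt.toComplex_neg]; linear_combination hk
    rw [mem_ball_zero_iff, hwk] at hw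
    have hk0 : -k ≠ 0 := by
      intro h
      rw [h, GaussianInt.toComplex_zero] at hwk
      exact hw0 hwk
    have h6 : 0 < (-k).norm := GaussianInt.norm_pos.mpr hk0
    have h7 : (((-k).norm : ℤ) : ℝ) = ‖((-k : GaussianInt) : ℂ)‖ ^ 2 := by
      rw [GaussianInt.intCast_real_norm, Complex.normSq_eq_norm_sq]
    have h8 : (1 : ℝ) ≤ (((-k).norm : ℤ) : ℝ) := by exact_mod_cast h6
    nlinarith [norm_nonneg ((-k : GaussianInt) : ℂ)]
  obtain ⟨w, hw, hw'⟩ := (h5.and ellE_eventually_ne_zero).exists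
  exact hw' (h4 hw)

lemma NonInt.one_add_I_mul {z : ℂ} (h1 : NonInt z) (h2 : NonInt (z + om)) :
    NonInt ((1 + Complex.I) * z) := by
  intro k hk
  have hz : z = -(om * k) := by
    linear_combination om * hk - z * one_add_I_mul_om
  rcases Int.even_or_odd' (k.re + k.im) with ⟨n, hn | hn⟩
  · refine h1 ⟨n, n - k.re⟩ ?_
    rw [hz, om_eq, GaussianInt.toComplex_def, GaussianInt.toComplex_def]
    have : (k.im : ℂ) = 2 * n - k.re := by
      have : k.im = 2 * n - k.re := by linarith
      rw [this]; push_cast; ring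
    simp only [this]
    push_cast
    linear_combination (n - k.re / 2 : ℂ) * Complex.I_sq
  · refine h2 ⟨n, n - k.re + 1⟩ ?_
    rw [hz, om_eq, GaussianInt.toComplex_def, GaussianInt.toComplex_def]
    have : (k.im : ℂ) = 2 * n + 1 - k.re := by
      have : k.im = 2 * n + 1 - k.re := by linarith
      rw [this]; push_cast; ring
    simp only [this]
    push_cast
    linear_combination (n + 1 / 2 - k.re / 2 : ℂ) * Complex.I_sq

theorem ellE_one_add_I_mul {u : ℂ} (hu : NonInt u) (hu' : NonInt (u + om)) :
    2 * Complex.I * ellE ((1 + Complex.I) * u) ^ 2 = ellE u ^ 2 + ellE (u + om) ^ 2 := by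
  set D : ℂ → ℂ := fun t =>
    2 * Complex.I * ellE ((1 + Complex.I) * t) ^ 2 - ellE t ^ 2 - ellE (t + om) ^ 2 with hD
  have hper : ∀ z (k : GaussianInt), D (z + k) = D z := by
    intro z k
    have h1 : (1 + Complex.I) * (z + k) =
        (1 + Complex.I) * z + (((1 + gI) * k : GaussianInt) : ℂ) := by
      rw [GaussianInt.toComplex_mul, GaussianInt.toComplex_add, GaussianInt.toComplex_one, coe_gI]
      ring
    simp only [hD]
    rw [h1, add_right_comm z, ellE_add, ellE_add, ellE_add, mul_pow, mul_pow, mul_pow, sq (sg _),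
      sq (sg _), sg_sq, sg_sq]
    ring
  have hom : ∀ z, D (z + om) = D z := by
    intro z
    have h1 : (1 + Complex.I) * (z + om) = (1 + Complex.I) * z + ((1 : GaussianInt) : ℂ) := by
      rw [GaussianInt.toComplex_one, mul_add, one_add_I_mul_om]
    simp only [hD]
    rw [h1, ellE_add, sg_one, ellE_om_add_om]
    ring
  have han : ∀ z, NonInt z → NonInt (z + om) → AnalyticAt ℂ D z := by
    intro z h1 h2
    refine AnalyticAt.sub (AnalyticAt.sub (analyticAt_const.mul (AnalyticAt.pow ?_ 2))
      ((analyticAt_ellE h1).pow 2)) ((analyticAt_ellE_add_om h2).pow 2)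
    exact AnalyticAt.fun_comp (analyticAt_ellE (h1.one_add_I_mul h2))
      (analyticAt_const.mul analyticAt_id)
  have h0 : RegularAt D 0 := by
    obtain ⟨d, hd, he⟩ := exists_ellE_near_zero
    have hd2 : AnalyticAt ℂ (fun w => d ((1 + Complex.I) * w)) 0 :=
      AnalyticAt.fun_comp (by simpa using hd) (analyticAt_const.mul analyticAt_id)
    have ht : Tendsto (fun w => (1 + Complex.I) * w) (𝓝 0) (𝓝 0) := by
      have : Tendsto (fun w => (1 + Complex.I) * w) (𝓝 0) (𝓝 ((1 + Complex.I) * 0)) :=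
        (continuous_const.mul continuous_id).tendsto _
      rwa [mul_zero] at this
    refine ⟨fun w => 2 * Complex.I * (2 * d ((1 + Complex.I) * w) +
        ((1 + Complex.I) * w) ^ 2 * d ((1 + Complex.I) * w) ^ 2) - (2 * d w + w ^ 2 * d w ^ 2) -
        ellE (w + om) ^ 2, ?_, ?_⟩
    · have hl : AnalyticAt ℂ (fun w => (1 + Complex.I) * w) (0 : ℂ) :=
        analyticAt_const.mul analyticAt_id
      have ho : AnalyticAt ℂ (fun w => ellE (w + om)) 0 :=
        analyticAt_ellE_add_om (by simpa using nonInt_om)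
      exact ((analyticAt_const.mul ((analyticAt_const.mul hd2).add
        ((hl.pow 2).mul (hd2.pow 2)))).sub ((analyticAt_const.mul hd).add
        ((analyticAt_id.pow 2).mul (hd.pow 2)))).sub (ho.pow 2)
    · rw [EventuallyEq, eventually_nhdsWithin_iff]
      filter_upwards [he, ht.eventually he] with w hw hw2 hw0
      have hw0' : w ≠ 0 := hw0
      have hne := one_add_I_ne
      simp only [hD]
      rw [hw, hw2]
      have h3 : ((1 + Complex.I)⁻¹) ^ 2 * (2 * Complex.I) = 1 := by
        rw [← om, om_eq]
        linear_combination (-1 : ℂ) * Complex.I_sq + (1 / 2 * Complex.I) * Complex.I_sq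
      have h4 : w * w⁻¹ = 1 := mul_inv_cancel₀ hw0'
      have h5 : (1 + Complex.I) * (1 + Complex.I)⁻¹ = 1 := mul_inv_cancel₀ hne
      have h6 : ((1 + Complex.I) * w) * ((1 + Complex.I) * w)⁻¹ = 1 :=
        mul_inv_cancel₀ (mul_ne_zero hne hw0')
      have h7 : 2 * Complex.I * (((1 + Complex.I) * w)⁻¹) ^ 2 = (w⁻¹) ^ 2 := by
        rw [mul_inv, mul_pow]
        linear_combination (w⁻¹) ^ 2 * h3
      linear_combination h7 + 2 * Complex.I * 2 * d ((1 + Complex.I) * w) * h6 - 2 * d w * h4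
  obtain ⟨c, hc⟩ := exists_eq_const_of_regularAt (regularAt_of_periods hper hom h0
    (fun z h1 h2 => AnalyticAt.regularAt (han z h1 h2))) hper
  have hDI : ∀ t, D (Complex.I * t) = -D t := by
    intro t
    have h1 : Complex.I * t + om = Complex.I * (t + om) + ((-gI : GaussianInt) : ℂ) := by
      rw [GaussianInt.toComplex_neg, coe_gI, om_eq]
      linear_combination (1 / 2 : ℂ) * Complex.I_sq
    have h2 : (1 + Complex.I) * (Complex.I * t) = Complex.I * ((1 + Complex.I) * t) := by ring
    simp only [hD]
    rw [h1, h2, ellE_add, ellE_I_mul, ellE_I_mul, ellE_I_mul, sg_neg, sg_gI]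
    linear_combination (2 * Complex.I * ellE ((1 + Complex.I) * t) ^ 2 - ellE t ^ 2 -
      ellE (t + om) ^ 2) * Complex.I_sq
  have hc0 : c = 0 := by
    have ht : Tendsto (fun w => Complex.I * w) (𝓝[≠] 0) (𝓝[≠] 0) := by
      refine tendsto_nhdsWithin_iff.mpr ⟨?_, ?_⟩
      · have : Tendsto (fun w => Complex.I * w) (𝓝 0) (𝓝 (Complex.I * 0)) :=
          (continuous_const.mul continuous_id).tendsto _
        rw [mul_zero] at this
        exact this.mono_left nhdsWithin_le_nhds
      · filter_upwards [self_mem_nhdsWithin] with w hw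
        exact mul_ne_zero Complex.I_ne_zero hw
    obtain ⟨w, hw, hw'⟩ := ((hc 0).and (ht.eventually (hc 0))).exists
    rw [hDI, hw] at hw'
    exact CharZero.eq_neg_self_iff.mp hw'.symm
  have := eq_of_eventually_const (han u hu hu') (hc u)
  simp only [hD, hc0] at this
  linear_combination this

/-- The completely multiplicative function `z ↦ z̄ |z|^(-2s)`. -/
def heckeTerm (s z : ℂ) : ℂ := (starRingEnd ℂ) z * ((Complex.normSq z : ℂ) ^ (-s))

lemma heckeTerm_mul (s z w : ℂ) : heckeTerm s (z * w) = heckeTerm s z * heckeTerm s w := by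
  unfold heckeTerm
  rw [map_mul, Complex.normSq_mul, Complex.ofReal_mul,
    Complex.mul_cpow_ofReal_nonneg (Complex.normSq_nonneg _) (Complex.normSq_nonneg _)]
  ring

lemma heckeTerm_one_left (z : ℂ) : heckeTerm 1 z = z⁻¹ := by
  rw [heckeTerm, Complex.cpow_neg_one, Complex.inv_def z, Complex.ofReal_inv]

lemma heckeTerm_zero_right (s : ℂ) : heckeTerm s 0 = 0 := by simp [heckeTerm]

lemma norm_heckeTerm {s z : ℂ} (hz : z ≠ 0) : ‖heckeTerm s z‖ = ‖z‖ ^ (1 - 2 * s.re) := by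
  have h : 0 < ‖z‖ := norm_pos_iff.mpr hz
  rw [heckeTerm, norm_mul, Complex.norm_conj,
    Complex.norm_cpow_eq_rpow_re_of_pos (Complex.normSq_pos.mpr hz), Complex.normSq_eq_norm_sq,
    ← Real.rpow_natCast ‖z‖ 2, ← Real.rpow_mul h.le, sub_eq_add_neg, Real.rpow_add h, Real.rpow_one]
  congr 2
  simp

lemma differentiable_heckeTerm (z : ℂ) : Differentiable ℂ fun s => heckeTerm s z := by
  by_cases hz : z = 0
  · simp only [hz, heckeTerm_zero_right]
    exact differentiable_const _
  · have h : (Complex.normSq z : ℂ) ≠ 0 := by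
      rw [Complex.ofReal_ne_zero]; exact (Complex.normSq_pos.mpr hz).ne'
    unfold heckeTerm
    intro s
    exact ((differentiable_id.neg s).const_cpow (Or.inl h)).const_mul _

lemma heckeTerm_eq_exp {s z : ℂ} (hz : z ≠ 0) : heckeTerm s z =
    Complex.exp ((starRingEnd ℂ) (Complex.log z) -
      s * (Complex.log z + (starRingEnd ℂ) (Complex.log z))) := by
  have h1 : Complex.log (Complex.normSq z : ℂ) =
      Complex.log z + (starRingEnd ℂ) (Complex.log z) := by
    rw [Complex.add_conj, Complex.log_re, Complex.normSq_eq_norm_sq,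
      ← Complex.ofReal_log (by positivity),
      Real.log_pow]
    push_cast
    ring
  have h : (Complex.normSq z : ℂ) ≠ 0 := by
    rw [Complex.ofReal_ne_zero]; exact (Complex.normSq_pos.mpr hz).ne'
  rw [heckeTerm, Complex.cpow_def_of_ne_zero h, h1, sub_eq_add_neg, Complex.exp_add, Complex.exp_conj,
    Complex.exp_log hz]
  congr 2
  ring

lemma norm_heckeTerm_one_add_sub_le {s e : ℂ} (hs : ‖s‖ ≤ 5 / 2) (he : ‖e‖ ≤ 1 / 9) :
    ‖heckeTerm s (1 + e) - 1 - ((starRingEnd ℂ) e - s * (e + (starRingEnd ℂ) e))‖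
      ≤ 90 * ‖e‖ ^ 2 := by
  have he1 : ‖e‖ < 1 := by linarith
  have hslit : 1 + e ∈ Complex.slitPlane := by
    have := Complex.mem_slitPlane_of_norm_lt_one he1
    exact this
  rw [heckeTerm_eq_exp (Complex.slitPlane_ne_zero hslit)]
  set l := Complex.log (1 + e) with hl
  have h1 : ‖l - e‖ ≤ (9 / 16) * ‖e‖ ^ 2 := by
    refine (Complex.norm_log_one_add_sub_self_le he1).trans ?_
    have : (1 - ‖e‖)⁻¹ ≤ 9 / 8 := by
      rw [inv_le_comm₀ (by linarith) (by norm_num)]; linarith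
    nlinarith [sq_nonneg ‖e‖]
  have hl2 : ‖l‖ ≤ (17 / 16) * ‖e‖ := by
    have : ‖l‖ ≤ ‖l - e‖ + ‖e‖ := by simpa using norm_add_le (l - e) e
    nlinarith [norm_nonneg e]
  have hlin : ∀ w : ℂ, ‖(starRingEnd ℂ) w - s * (w + (starRingEnd ℂ) w)‖ ≤ 6 * ‖w‖ := by
    intro w
    refine (norm_sub_le _ _).trans ?_
    rw [norm_mul, Complex.norm_conj]
    have h2 : ‖w + (starRingEnd ℂ) w‖ ≤ 2 * ‖w‖ := by
      refine (norm_add_le _ _).trans ?_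
      rw [Complex.norm_conj]; linarith
    nlinarith [norm_nonneg s, norm_nonneg (w + (starRingEnd ℂ) w), norm_nonneg w]
  set x := (starRingEnd ℂ) l - s * (l + (starRingEnd ℂ) l) with hx
  have hx1 : ‖x‖ ≤ (51 / 8) * ‖e‖ := (hlin l).trans (by linarith)
  have h3 := Complex.norm_exp_sub_one_sub_id_le (x := x) (by linarith)
  have h4 := hlin (l - e)
  have h5 : Complex.exp x - 1 - ((starRingEnd ℂ) e - s * (e + (starRingEnd ℂ) e)) =
      (Complex.exp x - 1 - x) +
        ((starRingEnd ℂ) (l - e) - s * ((l - e) + (starRingEnd ℂ) (l - e))) := by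
    rw [hx, map_sub]; ring
  rw [h5]
  refine (norm_add_le _ _).trans ?_
  nlinarith [norm_nonneg x, norm_nonneg e]

lemma norm_lap_heckeTerm_le {s β z : ℂ} (hs : ‖s‖ ≤ 5 / 2) (hs' : 3 / 4 ≤ s.re)
    (hz : 9 * ‖β‖ ≤ ‖z‖) (hz1 : 1 ≤ ‖z‖) :
    ‖lap (heckeTerm s) β z‖ ≤ 360 * ‖β‖ ^ 2 * ‖z‖ ^ (-(5 / 2) : ℝ) := by
  have hz0 : z ≠ 0 := by rintro rfl; norm_num at hz1
  have hzp : 0 < ‖z‖ := by linarith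
  set e := β / z with he
  have hen : ‖e‖ = ‖β‖ / ‖z‖ := norm_div _ _
  have he9 : ‖e‖ ≤ 1 / 9 := by
    rw [hen, div_le_iff₀ hzp]; linarith
  have hze : z * e = β := by rw [he]; field_simp
  have key : lap (heckeTerm s) β z = heckeTerm s z * -(
      (heckeTerm s (1 + e) - 1 - ((starRingEnd ℂ) e - s * (e + (starRingEnd ℂ) e))) +
      (heckeTerm s (1 + -e) - 1 - ((starRingEnd ℂ) (-e) - s * (-e + (starRingEnd ℂ) (-e)))) +
      (heckeTerm s (1 + Complex.I * e) - 1 - ((starRingEnd ℂ) (Complex.I * e) -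
        s * (Complex.I * e + (starRingEnd ℂ) (Complex.I * e)))) +
      (heckeTerm s (1 + -(Complex.I * e)) - 1 - ((starRingEnd ℂ) (-(Complex.I * e)) -
        s * (-(Complex.I * e) + (starRingEnd ℂ) (-(Complex.I * e)))))) := by
    have h1 : z + β = z * (1 + e) := by rw [← hze]; ring
    have h2 : z - β = z * (1 + -e) := by rw [← hze]; ring
    have h3 : z + Complex.I * β = z * (1 + Complex.I * e) := by rw [← hze]; ring
    have h4 : z - Complex.I * β = z * (1 + -(Complex.I * e)) := by rw [← hze]; ring
    rw [lap, h1, h2, h3, h4]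
    simp only [heckeTerm_mul, map_neg]
    ring
  have hIe : ‖Complex.I * e‖ = ‖e‖ := by simp
  have b1 := norm_heckeTerm_one_add_sub_le hs he9
  have b2 := norm_heckeTerm_one_add_sub_le hs (e := -e) (by rwa [norm_neg])
  have b3 := norm_heckeTerm_one_add_sub_le hs (e := Complex.I * e) (by rwa [hIe])
  have b4 := norm_heckeTerm_one_add_sub_le hs (e := -(Complex.I * e)) (by rwa [norm_neg, hIe])
  rw [norm_neg] at b2
  rw [hIe] at b3
  rw [norm_neg, hIe] at b4
  rw [key, norm_mul, norm_neg, norm_heckeTerm hz0]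
  have hsum := (norm_add₄_le.trans (add_le_add (add_le_add (add_le_add b1 b2) b3) b4))
  refine (mul_le_mul_of_nonneg_left hsum (by positivity)).trans ?_
  have hpow : ‖z‖ ^ (1 - 2 * s.re) ≤ ‖z‖ ^ (-(5 / 2) + 2 : ℝ) :=
    Real.rpow_le_rpow_of_exponent_le hz1 (by linarith)
  have hpow2 : ‖z‖ ^ (-(5 / 2) + 2 : ℝ) = ‖z‖ ^ (-(5 / 2) : ℝ) * ‖z‖ ^ 2 := by
    rw [Real.rpow_add hzp]; norm_num
  rw [hpow2] at hpow
  refine (mul_le_mul_of_nonneg_right hpow (by positivity)).trans (le_of_eq ?_)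
  rw [hen]
  field_simp
  ring

lemma summable_heckeTerm {s : ℂ} (hs : 3 / 2 < s.re) (ρ : ℂ) {ϕ : GaussianInt → ℂ}
    (hϕ : ∀ k, ‖ϕ k‖ ≤ 1) : Summable fun k : GaussianInt => ϕ k * heckeTerm s (ρ + k) := by
  refine Summable.of_norm_bounded
    (summable_shift_rpow ρ (r := 2 * s.re - 1) (by linarith)) fun k => ?_
  rw [norm_mul]
  by_cases h : ρ + (k : ℂ) = 0
  · rw [h, heckeTerm_zero_right, norm_zero, mul_zero]
    positivity
  · rw [norm_heckeTerm h, neg_sub]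
    exact mul_le_of_le_one_left (by positivity) (hϕ k)

lemma tsum_lap_heckeTerm {s : ℂ} (hs : 3 / 2 < s.re) (ρ : ℂ) (β : GaussianInt)
    {ϕ : GaussianInt → ℂ} (hϕ : ∀ k, ‖ϕ k‖ ≤ 1) (h1 : ∀ k, ϕ (k + β) = -ϕ k)
    (h2 : ∀ k, ϕ (k + gI * β) = -ϕ k) :
    ∑' k : GaussianInt, ϕ k * lap (heckeTerm s) β (ρ + k) =
      8 * ∑' k : GaussianInt, ϕ k * heckeTerm s (ρ + k) := by
  have hs0 := (summable_heckeTerm hs ρ hϕ).hasSum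
  have hshift : ∀ c : GaussianInt, (∀ k, ϕ (k + c) = -ϕ k) →
      HasSum (fun k : GaussianInt => ϕ k * heckeTerm s (ρ + k + c))
        (-∑' k : GaussianInt, ϕ k * heckeTerm s (ρ + k)) := by
    intro c hc
    have := ((Equiv.addRight c).hasSum_iff.mpr hs0).neg
    refine this.congr_fun ?_
    intro k
    simp only [Function.comp_apply, Equiv.coe_addRight, GaussianInt.toComplex_add, hc]
    rw [add_assoc]
    ring
  have h1' : ∀ k, ϕ (k + -β) = -ϕ k := fun k => by
    have := h1 (k + -β); rw [neg_add_cancel_right] at this; rw [this, neg_neg]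
  have h2' : ∀ k, ϕ (k + -(gI * β)) = -ϕ k := fun k => by
    have := h2 (k + -(gI * β)); rw [neg_add_cancel_right] at this; rw [this, neg_neg]
  have h := ((((hs0.mul_left 4).sub (hshift β h1)).sub (hshift _ h1')).sub (hshift _ h2)).sub
    (hshift _ h2')
  have h3 := h.tsum_eq
  simp only [GaussianInt.toComplex_neg, GaussianInt.toComplex_mul, coe_gI,
    ← sub_eq_add_neg] at h3
  calc _ = _ := tsum_congr fun k => by simp only [lap]; ring
    _ = _ := h3
    _ = _ := by ring

lemma differentiableOn_tsum_lap (ρ β : ℂ) {ϕ : GaussianInt → ℂ} (hϕ : ∀ k, ‖ϕ k‖ ≤ 1) :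
    DifferentiableOn ℂ (fun s => ∑' k : GaussianInt, ϕ k * lap (heckeTerm s) β (ρ + k))
      (Metric.ball (3 / 2) (7 / 10)) := by
  set M := max 1 (9 * ‖β‖) with hM
  have hfin : {k : GaussianInt | ¬ M ≤ ‖ρ + (k : ℂ)‖}.Finite := by
    refine (finite_norm_le (M + ‖ρ‖)).subset ?_
    intro k hk
    simp only [Set.mem_ofPred_eq, not_le] at hk ⊢
    have := norm_sub_le (ρ + (k : ℂ)) ρ
    rw [add_sub_cancel_left] at this
    linarith
  set S := hfin.toFinset with hS
  have hbound : ∀ s ∈ Metric.ball (3 / 2 : ℂ) (7 / 10), ∀ k : GaussianInt, M ≤ ‖ρ + (k : ℂ)‖ →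
      ‖ϕ k * lap (heckeTerm s) β (ρ + k)‖ ≤
        360 * ‖β‖ ^ 2 * ‖ρ + (k : ℂ)‖ ^ (-(5 / 2) : ℝ) := by
    intro s hs k hk
    rw [Metric.mem_ball, dist_eq_norm] at hs
    have h1 : ‖s‖ ≤ 5 / 2 := by
      have := norm_add_le (s - 3 / 2) (3 / 2)
      rw [sub_add_cancel] at this
      have h3 : ‖(3 / 2 : ℂ)‖ = 3 / 2 := by norm_num
      linarith
    have h2 : 3 / 4 ≤ s.re := by
      have := (Complex.abs_re_le_norm (s - 3 / 2)).trans hs.le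
      rw [abs_le] at this
      norm_num at this
      linarith
    rw [norm_mul]
    exact (mul_le_of_le_one_left (norm_nonneg _) (hϕ k)).trans
      (norm_lap_heckeTerm_le h1 h2 ((le_max_right _ _).trans hk) ((le_max_left _ _).trans hk))
  have hsumm := (summable_shift_rpow ρ (r := 5 / 2) (by norm_num)).mul_left (360 * ‖β‖ ^ 2)
  have hdiff : ∀ k : GaussianInt, Differentiable ℂ fun s => ϕ k * lap (heckeTerm s) β (ρ + k) := by
    intro k
    unfold lap
    have h := differentiable_heckeTerm
    exact (((((h _).const_mul 4).sub (h _)).sub (h _)).sub (h _)).sub (h _) |>.const_mul _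
  have hsplit : ∀ s ∈ Metric.ball (3 / 2 : ℂ) (7 / 10),
      ∑' k : GaussianInt, ϕ k * lap (heckeTerm s) β (ρ + k) =
      ∑ k ∈ S, ϕ k * lap (heckeTerm s) β (ρ + k) +
      ∑' k : {k // k ∉ S}, ϕ k * lap (heckeTerm s) β (ρ + (k : GaussianInt)) := by
    intro s hs
    refine (Summable.sum_add_tsum_subtype_compl ?_ S).symm
    refine Summable.of_norm_bounded_eventually hsumm ?_
    rw [Filter.eventually_cofinite]
    refine hfin.subset ?_
    intro k hk h
    exact hk (hbound s hs k h)
  refine DifferentiableOn.congr ?_ hsplit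
  refine DifferentiableOn.fun_add ?_ ?_
  · exact DifferentiableOn.fun_sum fun k _ => (hdiff k).differentiableOn
  · refine differentiableOn_tsum_of_summable_norm
      (hsumm.comp_injective (Subtype.val_injective (p := fun k => k ∉ S)))
      (fun k => (hdiff k).differentiableOn) Metric.isOpen_ball ?_
    rintro ⟨k, hk⟩ s hs
    refine hbound s hs k ?_
    by_contra h
    exact hk (by simpa [hS] using h)

/-- Evaluation at `s = 1` of the analytic continuation of a twisted Hecke series. -/
theorem continuation_at_one {F c d : ℂ → ℂ} (hF : DifferentiableOn ℂ F {s : ℂ | 0 < s.re})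
    (hc : Differentiable ℂ c) (hd : Differentiable ℂ d) (ρ : ℂ) (β : GaussianInt)
    {ϕ : GaussianInt → ℂ} (hϕ : ∀ k, ‖ϕ k‖ ≤ 1) (h1 : ∀ k, ϕ (k + β) = -ϕ k)
    (h2 : ∀ k, ϕ (k + gI * β) = -ϕ k)
    (h : ∀ s : ℂ, 3 / 2 < s.re →
      F s * c s = d s * ∑' k : GaussianInt, ϕ k * heckeTerm s (ρ + k)) :
    F 1 * c 1 = d 1 * ((1 / 8) * ∑' k : GaussianInt, ϕ k * lap (·⁻¹) β (ρ + k)) := by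
  have hU : Metric.ball (3 / 2 : ℂ) (7 / 10) ⊆ {s : ℂ | 0 < s.re} := by
    intro s hs
    rw [Metric.mem_ball, dist_eq_norm] at hs
    have := (Complex.abs_re_le_norm (s - 3 / 2)).trans hs.le
    rw [abs_le] at this
    norm_num at this
    simp only [Set.mem_ofPred_eq]
    linarith
  have hL : DifferentiableOn ℂ (fun s => F s * c s) (Metric.ball (3 / 2) (7 / 10)) :=
    (hF.mono hU).fun_mul hc.differentiableOn
  have hR : DifferentiableOn ℂ (fun s => d s * ((1 / 8) *
      ∑' k : GaussianInt, ϕ k * lap (heckeTerm s) β (ρ + k))) (Metric.ball (3 / 2) (7 / 10)) :=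
    hd.differentiableOn.fun_mul ((differentiableOn_tsum_lap ρ β hϕ).const_mul _)
  have heq := (hL.analyticOnNhd Metric.isOpen_ball).eqOn_of_preconnected_of_eventuallyEq
    (hR.analyticOnNhd Metric.isOpen_ball) (convex_ball _ _).isPreconnected (z₀ := 2)
    (by rw [Metric.mem_ball, dist_eq_norm]; norm_num)
    (by
      have : {s : ℂ | 3 / 2 < s.re} ∈ 𝓝 (2 : ℂ) :=
        (isOpen_lt continuous_const Complex.continuous_re).mem_nhds (by norm_num)
      filter_upwards [this] with s hs
      rw [h s hs, tsum_lap_heckeTerm hs ρ β hϕ h1 h2]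
      ring)
  have h3 := heq (x := 1) (by rw [Metric.mem_ball, dist_eq_norm]; norm_num)
  have h4 : heckeTerm 1 = (·⁻¹) := funext heckeTerm_one_left
  simpa only [h4] using h3

lemma sg_mul_of_sg_eq {a : GaussianInt} (ha : sg a = -1) (k : GaussianInt) : sg (a * k) = sg k := by
  have hodd : Odd (a.re + a.im) := by
    rcases Int.even_or_odd (a.re + a.im) with h | h
    · rw [sg, h.neg_one_zpow] at ha; norm_num at ha
    · exact h
  obtain ⟨m, hm⟩ := hodd
  unfold sg
  simp only [Zsqrtd.re_mul, Zsqrtd.im_mul]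
  rw [show a.re * k.re + -1 * a.im * k.im + (a.re * k.im + a.im * k.re) =
      (k.re + k.im) + 2 * (m * (k.re + k.im) - a.im * k.im) by linear_combination (k.re + k.im) * hm,
    zpow_add₀ (by norm_num), zpow_mul]
  norm_num

lemma lap_inv_mul {β : ℂ} (z : ℂ) : lap (·⁻¹) β (β * z) = β⁻¹ * lap (·⁻¹) 1 z := by
  simp only [lap, mul_one]
  rw [show β * z + β = β * (z + 1) by ring, show β * z - β = β * (z - 1) by ring,
    show β * z + Complex.I * β = β * (z + Complex.I) by ring,
    show β * z - Complex.I * β = β * (z - Complex.I) by ring]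
  simp only [mul_inv]
  ring

lemma summable_lap_inv (ρ β : ℂ) {ϕ : GaussianInt → ℂ} (hϕ : ∀ k, ‖ϕ k‖ ≤ 1) :
    Summable fun k : GaussianInt => ϕ k * lap (·⁻¹) β (ρ + k) := by
  have h4 : heckeTerm 1 = (·⁻¹) := funext heckeTerm_one_left
  refine Summable.of_norm_bounded_eventually
    ((summable_shift_rpow ρ (r := 5 / 2) (by norm_num)).mul_left (360 * ‖β‖ ^ 2)) ?_
  filter_upwards [eventually_half_le ρ, eventually_norm_gt (2 * max 1 (9 * ‖β‖))] with k hk hk'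
  have hM : max 1 (9 * ‖β‖) ≤ ‖ρ + (k : ℂ)‖ := by linarith
  rw [norm_mul, ← h4]
  exact (mul_le_of_le_one_left (norm_nonneg _) (hϕ k)).trans
    (norm_lap_heckeTerm_le (by norm_num) (by norm_num) ((le_max_right _ _).trans hM)
      ((le_max_left _ _).trans hM))

/-- Decomposition of a Gaussian integer into a residue class and a quotient. -/
def residueEquiv {β : GaussianInt} (hβ : β ≠ 0) :
    (GaussianInt ⧸ Ideal.span {β}) × GaussianInt ≃ GaussianInt :=
  Equiv.ofBijective (fun x => x.1.out + β * x.2) (by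
    have hmk : ∀ (q : GaussianInt ⧸ Ideal.span {β}) (k : GaussianInt),
        Ideal.Quotient.mk (Ideal.span {β}) (q.out + β * k) = q := by
      intro q k
      rw [map_add, map_mul, Ideal.Quotient.eq_zero_iff_mem.mpr (Ideal.mem_span_singleton_self β),
        zero_mul, add_zero]
      exact Ideal.Quotient.mk_out q
    constructor
    · rintro ⟨q, k⟩ ⟨q', k'⟩ h
      have h1 : q = q' := by
        rw [← hmk q k, ← hmk q' k']
        exact congrArg _ h
      subst h1
      have h2 : β * k = β * k' := add_left_cancel h
      rw [mul_left_cancel₀ hβ h2]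
    · intro z
      have h1 : z - (Ideal.Quotient.mk (Ideal.span {β}) z).out ∈ Ideal.span {β} := by
        rw [← Ideal.Quotient.eq]
        exact (Ideal.Quotient.mk_out _).symm
      obtain ⟨k, hk⟩ := Ideal.mem_span_singleton.mp h1
      exact ⟨(Ideal.Quotient.mk (Ideal.span {β}) z, k), by
        show _ + β * k = z
        rw [← hk]; ring⟩)

lemma residueEquiv_apply {β : GaussianInt} (hβ : β ≠ 0)
    (q : GaussianInt ⧸ Ideal.span {β}) (k : GaussianInt) :
    residueEquiv hβ (q, k) = q.out + β * k := rfl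

theorem tsum_lap_inv_eq {β : GaussianInt} (hβ : β ≠ 0) (hsg : sg β = -1)
    [Fintype (GaussianInt ⧸ Ideal.span {β})] (ρ : ℂ) {X : GaussianInt → ℂ}
    (hX : ∀ k, ‖X k‖ ≤ 1) (hper : ∀ a k, X (a + β * k) = X a) :
    (1 / 8) * ∑' k : GaussianInt, (X k * sg k) * lap (·⁻¹) β (ρ + k) =
      (β : ℂ)⁻¹ * ∑ q : GaussianInt ⧸ Ideal.span {β},
        X q.out * sg q.out * ellE ((ρ + (q.out : GaussianInt)) / β) := by
  have hβ' : (β : ℂ) ≠ 0 := GaussianInt.toComplex_eq_zero.not.mpr hβ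
  have hs := summable_lap_inv ρ β (ϕ := fun k => X k * sg k)
    (fun k => by rw [norm_mul, norm_sg, mul_one]; exact hX k)
  have hprod := ((residueEquiv hβ).summable_iff.mpr hs).tsum_prod
  simp only [Function.comp_def] at hprod
  rw [← (residueEquiv hβ).tsum_eq, hprod, tsum_fintype, Finset.mul_sum,
    Finset.mul_sum]
  refine Finset.sum_congr rfl fun q _ => ?_
  rw [ellE, ← tsum_mul_left (a := (1 / 8 : ℂ)), ← tsum_mul_left (a := (1 / 8 : ℂ)),
    ← tsum_mul_left, ← tsum_mul_left]
  refine tsum_congr fun k => ?_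
  simp only [residueEquiv_apply, hper, sg_add, sg_mul_of_sg_eq hsg,
    GaussianInt.toComplex_add, GaussianInt.toComplex_mul]
  rw [show ρ + ((q.out : GaussianInt) + (β : ℂ) * k) =
    β * ((ρ + (q.out : GaussianInt)) / β + k) by field_simp; ring, lap_inv_mul]
  ring

section DivisionValues

lemma exists_valuationSubring_two : ∃ V : ValuationSubring ℂ, V.valuation 2 < 1 := by
  let A : Subring ℂ := (Int.castRingHom ℂ).range
  let t : A := ⟨2, 2, by simp⟩
  have hI : Ideal.span {t} ≠ ⊤ := by
    intro h
    have h1 : (1 : A) ∈ Ideal.span {t} := by rw [h]; exact Submodule.mem_top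
    obtain ⟨⟨_, n, rfl⟩, hn⟩ := Ideal.mem_span_singleton.mp h1
    have h2 : (1 : ℂ) = 2 * (n : ℂ) := congrArg Subtype.val hn
    have h3 : (1 : ℤ) = 2 * n := by exact_mod_cast h2
    omega
  obtain ⟨V, -, hV⟩ := Ideal.image_subset_nonunits_valuationSubring _ hI
  exact ⟨V, V.mem_nonunits_iff.mp
    (hV ⟨t, Ideal.mem_span_singleton_self t, rfl⟩)⟩

variable {Γ₀ : Type*} [LinearOrderedCommGroupWithZero Γ₀] (v : Valuation ℂ Γ₀)

lemma val_intCast_le_one (n : ℤ) : v (n : ℂ) ≤ 1 := by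
  have : (n : ℂ) ∈ v.integer := intCast_mem _ n
  exact this

lemma val_sub_one_lt_of_pow_four (h2 : v 2 < 1) {z : ℂ} (hz : v (z ^ 4 - 1) < 1) :
    v (z - 1) < 1 := by
  have h1 : v z ≤ 1 := by
    have h : v (z ^ 4) ≤ 1 := by
      have h3 := v.map_add (z ^ 4 - 1) 1
      rw [sub_add_cancel, map_one] at h3
      exact h3.trans (max_le hz.le le_rfl)
    rw [map_pow] at h
    exact (pow_le_one_iff (by norm_num)).mp h
  have hzi : z ∈ v.integer := h1
  have hp : 2 * z ^ 3 - 3 * z ^ 2 + 2 * z - 1 ∈ v.integer := by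
    refine sub_mem (add_mem (sub_mem ?_ ?_) ?_) (one_mem _)
    · exact mul_mem (by exact_mod_cast intCast_mem v.integer 2) (pow_mem hzi _)
    · exact mul_mem (by exact_mod_cast intCast_mem v.integer 3) (pow_mem hzi _)
    · exact mul_mem (by exact_mod_cast intCast_mem v.integer 2) hzi
  have h4 : v ((z - 1) ^ 4) < 1 := by
    rw [show (z - 1) ^ 4 = (z ^ 4 - 1) - 2 * (2 * z ^ 3 - 3 * z ^ 2 + 2 * z - 1) by ring]
    refine v.map_sub_lt hz ?_
    rw [map_mul]
    exact mul_lt_one_of_lt_of_le h2 hp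
  rw [map_pow] at h4
  exact (pow_lt_one_iff (by norm_num)).mp h4

lemma sum_ne_zero_of_val (h2 : v 2 < 1) {ι : Type*} {S : Finset ι} (hS : Odd S.card)
    {f : ι → ℂ} {A : ℂ} (hA : A ≠ 0) (hf : ∀ q ∈ S, v (f q ^ 4 / A - 1) < 1) :
    ∑ q ∈ S, f q ≠ 0 := by
  obtain ⟨κ, hκ⟩ := IsAlgClosed.exists_pow_nat_eq A (n := 4) (by norm_num)
  have hκ0 : κ ≠ 0 := by rintro rfl; apply hA; rw [← hκ]; norm_num
  intro h0
  have h1 : v (∑ q ∈ S, (f q / κ - 1)) < 1 := by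
    refine v.map_sum_lt one_ne_zero fun q hq => val_sub_one_lt_of_pow_four v h2 ?_
    rw [div_pow, hκ]
    exact hf q hq
  rw [Finset.sum_sub_distrib, ← Finset.sum_div, h0, zero_div, zero_sub, Valuation.map_neg,
    Finset.sum_const, nsmul_eq_mul, mul_one] at h1
  obtain ⟨m, hm⟩ := hS
  have h3 : v ((2 : ℂ) * (m : ℤ)) < 1 := by
    rw [map_mul]
    exact mul_lt_one_of_lt_of_le h2 (val_intCast_le_one v m)
  have h4 := v.map_sub_lt h1 h3
  rw [hm] at h4
  push_cast at h4
  rw [add_sub_cancel_left, map_one] at h4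
  exact lt_irrefl _ h4

lemma val_I : v Complex.I = 1 := by
  have h : v Complex.I ^ 4 = 1 := by rw [← map_pow, Complex.I_pow_four, map_one]
  exact (pow_eq_one_iff.mp h).resolve_right (by norm_num)

lemma val_eq_one_of_dynamics (h2 : v 2 < 1) {ι : Type*} [Finite ι] {W : ι → ℂ} {s : ι → ι}
    (hW : ∀ i, W i ≠ 0) (hs : ∀ i, 2 * Complex.I * W (s i) = W i - (W i)⁻¹) (i : ι) :
    v (W i) = 1 := by
  let M : ι → Γ₀ := fun i => max (v (W i)) (v (W i)⁻¹)
  have : Nonempty ι := ⟨i⟩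
  obtain ⟨j, hj⟩ := Finite.exists_max M
  have hval : ∀ i, v 2 * v (W (s i)) = v (W i - (W i)⁻¹) := by
    intro i
    rw [← hs, map_mul, map_mul, val_I, mul_one]
  have hj1 : M j ≤ 1 := by
    by_contra! hlt
    have h3 : v (W j - (W j)⁻¹) = M j := by
      have hpos := (Valuation.pos_iff v).mpr (hW j)
      rcases lt_max_iff.mp hlt with h | h
      · have h' : v (W j)⁻¹ < v (W j) := by
          rw [map_inv₀]
          exact (inv_lt_one_of_one_lt₀ h).trans h
        rw [Valuation.map_sub_eq_of_lt_left v h']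
        exact (max_eq_left h'.le).symm
      · have h' : v (W j) < v (W j)⁻¹ := by
          refine lt_trans ?_ h
          rw [map_inv₀] at h
          exact (one_lt_inv₀ hpos).mp h
        rw [Valuation.map_sub_eq_of_lt_right v h']
        exact (max_eq_right h'.le).symm
    have h4 : v (W (s j)) ≤ M j := (le_max_left _ _).trans (hj (s j))
    rw [← hval] at h3
    have h5 : v 2 * v (W (s j)) < M j :=
      (mul_le_mul_right h4 _).trans_lt (mul_lt_of_lt_one_left (zero_lt_one.trans hlt) h2)
    exact h5.ne h3
  have h6 : v (W i) ≤ 1 := (le_max_left _ _).trans ((hj i).trans hj1)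
  have h7 : v (W i)⁻¹ ≤ 1 := (le_max_right _ _).trans ((hj i).trans hj1)
  refine le_antisymm h6 ?_
  rw [map_inv₀] at h7
  exact (inv_le_one₀ ((Valuation.pos_iff v).mpr (hW i))).mp h7

end DivisionValues

lemma eq_of_pow_four_eq_one {x : ℂ} (hx : x ^ 4 = 1) :
    x = 1 ∨ x = -1 ∨ x = Complex.I ∨ x = -Complex.I := by
  have h : (x - 1) * ((x + 1) * ((x - Complex.I) * (x + Complex.I))) = 0 := by
    linear_combination hx + (1 - x ^ 2) * Complex.I_sq
  rcases mul_eq_zero.mp h with h | h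
  · exact Or.inl (sub_eq_zero.mp h)
  rcases mul_eq_zero.mp h with h | h
  · exact Or.inr (Or.inl (eq_neg_of_add_eq_zero_left h))
  rcases mul_eq_zero.mp h with h | h
  · exact Or.inr (Or.inr (Or.inl (sub_eq_zero.mp h)))
  · exact Or.inr (Or.inr (Or.inr (eq_neg_of_add_eq_zero_left h)))

open Classical in
lemma sum_eq_four_mul_sum_filter {Q : Type*} [Fintype Q] (σ : Equiv.Perm Q) {x f : Q → ℂ} {j : ℂ}
    (hj : j = Complex.I ∨ j = -Complex.I) (hx : ∀ q, x (σ q) = j * x q)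
    (hf : ∀ q, f (σ q) = f q) (h0 : ∀ q, x q ^ 4 ≠ 1 → f q = 0) :
    ∑ q, f q = 4 * ∑ q with x q = 1, f q := by
  have hj0 : j ≠ 0 := by rcases hj with rfl | rfl <;> simp
  have hstep : ∀ n : ℕ, (∑ q, if x q = j ^ (n + 1) then f q else 0) =
      ∑ q, if x q = j ^ n then f q else 0 := by
    intro n
    rw [← Equiv.sum_comp σ]
    refine Finset.sum_congr rfl fun q _ => ?_
    simp only [hx, hf, pow_succ', mul_right_inj' hj0]
  have hpt : ∀ q, f q = (if x q = j ^ 0 then f q else 0) + (if x q = j ^ 1 then f q else 0) +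
      (if x q = j ^ 2 then f q else 0) + (if x q = j ^ 3 then f q else 0) := by
    intro q
    by_cases h : x q ^ 4 = 1
    · rcases hj with rfl | rfl <;> rcases eq_of_pow_four_eq_one h with h | h | h | h <;>
        norm_num [h, Complex.ext_iff, pow_succ]
    · simp [h0 q h]
  rw [Finset.sum_congr rfl fun q _ => hpt q]
  simp only [Finset.sum_add_distrib]
  rw [hstep 2, hstep 1, hstep 0, Finset.sum_filter]
  simp only [pow_zero]
  ring

section Division

variable {π : GaussianInt}

lemma nonInt_div (h0 : π ≠ 0) {c : GaussianInt} (hc : ¬ π ∣ c) : NonInt ((c : ℂ) / π) := by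
  have h0' : (π : ℂ) ≠ 0 := GaussianInt.toComplex_eq_zero.not.mpr h0
  intro k h
  apply hc
  refine ⟨-k, ?_⟩
  rw [← GaussianInt.toComplex_inj, GaussianInt.toComplex_mul, GaussianInt.toComplex_neg]
  field_simp at h
  linear_combination h

lemma nonInt_div_add_om (hp : Prime π) (hodd : ¬ π ∣ 1 + gI) {c : GaussianInt} (hc : ¬ π ∣ c) :
    NonInt ((c : ℂ) / π + om) := by
  have h0' : (π : ℂ) ≠ 0 := GaussianInt.toComplex_eq_zero.not.mpr hp.ne_zero
  intro k h
  have h1 : π ∣ (1 + gI) * c := by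
    refine ⟨-1 - (1 + gI) * k, ?_⟩
    rw [← GaussianInt.toComplex_inj]
    simp only [GaussianInt.toComplex_mul, GaussianInt.toComplex_add, GaussianInt.toComplex_sub,
      GaussianInt.toComplex_neg, GaussianInt.toComplex_one, coe_gI]
    have h2 : (c : ℂ) + π * om + π * k = 0 := by
      have : (π : ℂ) * ((c : ℂ) / π + om + k) = 0 := by rw [h, mul_zero]
      rw [← this]; field_simp
    linear_combination (1 + Complex.I) * h2 - π * one_add_I_mul_om
  rcases hp.dvd_or_dvd h1 with h | h
  · exact hodd h
  · exact hc h

lemma ellE_div_add (h0 : π ≠ 0) (c k : GaussianInt) (w : ℂ) :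
    ellE (((c + π * k : GaussianInt) : ℂ) / π + w) = sg k * ellE ((c : ℂ) / π + w) := by
  have h0' : (π : ℂ) ≠ 0 := GaussianInt.toComplex_eq_zero.not.mpr h0
  rw [← ellE_add]
  congr 1
  simp only [GaussianInt.toComplex_mul, GaussianInt.toComplex_add]
  field_simp
  ring

/-- Congruence modulo `2` of normalized values of `ellE` at division points. -/
theorem exists_val_ellE_div {Γ₀ : Type*} [LinearOrderedCommGroupWithZero Γ₀] (v : Valuation ℂ Γ₀)
    (h2 : v 2 < 1) (hp : Prime π) (hodd : ¬ π ∣ 1 + gI)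
    [Finite (GaussianInt ⧸ Ideal.span {π})] :
    ∃ A : ℂ, A ≠ 0 ∧ ∀ c : GaussianInt, ¬ π ∣ c →
      v (ellE ((c : ℂ) / π) ^ 4 / A - 1) < 1 ∧ v (ellE ((c : ℂ) / π + om) ^ 4 / A - 1) < 1 := by
  obtain ⟨K, hK0, hK⟩ := exists_ellE_mul_shift
  have hpr : (Ideal.span {π}).IsPrime := (Ideal.span_singleton_prime hp.ne_zero).mpr hp
  have hmk0 : ∀ c : GaussianInt, Ideal.Quotient.mk (Ideal.span {π}) c = 0 ↔ π ∣ c := fun c => by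
    rw [Ideal.Quotient.eq_zero_iff_mem, Ideal.mem_span_singleton]
  let e : GaussianInt → ℂ := fun c => ellE ((c : ℂ) / π) ^ 2 / (Complex.I * K)
  have hI : Complex.I ≠ 0 := Complex.I_ne_zero
  have hI2 := Complex.I_sq
  have hprod : ∀ c, ¬ π ∣ c → ellE ((c : ℂ) / π) * ellE ((c : ℂ) / π + om) = K := fun c hc =>
    hK _ (nonInt_div hp.ne_zero hc) (nonInt_div_add_om hp hodd hc)
  have hE0 : ∀ c, ¬ π ∣ c → ellE ((c : ℂ) / π) ≠ 0 := fun c hc h => by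
    have := hprod c hc
    rw [h, zero_mul] at this
    exact hK0 this.symm
  have he_mk : ∀ c d : GaussianInt, Ideal.Quotient.mk (Ideal.span {π}) c =
      Ideal.Quotient.mk (Ideal.span {π}) d → e c = e d := by
    intro c d h
    rw [Ideal.Quotient.eq, Ideal.mem_span_singleton] at h
    obtain ⟨k, hk⟩ := h
    have h3 := ellE_div_add hp.ne_zero d k 0
    rw [← hk, add_sub_cancel, add_zero, add_zero] at h3
    simp only [e]
    rw [h3, mul_pow, pow_two (sg k), sg_sq, one_mul]
  have he0 : ∀ c, ¬ π ∣ c → e c ≠ 0 := fun c hc =>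
    div_ne_zero (pow_ne_zero _ (hE0 c hc)) (mul_ne_zero hI hK0)
  have hrel : ∀ c, ¬ π ∣ c → 2 * Complex.I * e ((1 + gI) * c) = e c - (e c)⁻¹ := by
    intro c hc
    have h3 := ellE_one_add_I_mul (nonInt_div hp.ne_zero hc) (nonInt_div_add_om hp hodd hc)
    have h4 : ellE ((c : ℂ) / π + om) = K / ellE ((c : ℂ) / π) := by
      rw [eq_div_iff (hE0 c hc), mul_comm]; exact hprod c hc
    have h5 : (((1 + gI) * c : GaussianInt) : ℂ) / π = (1 + Complex.I) * ((c : ℂ) / π) := by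
      simp only [GaussianInt.toComplex_mul, GaussianInt.toComplex_add, GaussianInt.toComplex_one,
        coe_gI]
      ring
    simp only [e]
    rw [h5, mul_div_assoc', h3, h4]
    have h6 := hE0 c hc
    field_simp
    linear_combination K ^ 2 * hI2
  have hnd : ∀ c, ¬ π ∣ c → ¬ π ∣ (1 + gI) * c := fun c hc h =>
    (hp.dvd_or_dvd h).elim hodd hc
  let ι := {q : GaussianInt ⧸ Ideal.span {π} // q ≠ 0}
  have hout : ∀ q : ι, ¬ π ∣ (q : GaussianInt ⧸ Ideal.span {π}).out := by
    intro q h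
    rw [← hmk0, Ideal.Quotient.mk_out] at h
    exact q.2 h
  let W : ι → ℂ := fun q => e (q : GaussianInt ⧸ Ideal.span {π}).out
  let s : ι → ι := fun q => ⟨Ideal.Quotient.mk (Ideal.span {π})
    ((1 + gI) * (q : GaussianInt ⧸ Ideal.span {π}).out), by
      rw [Ne, hmk0]; exact hnd _ (hout q)⟩
  have hval := val_eq_one_of_dynamics v h2 (W := W) (s := s) (fun q => he0 _ (hout q)) (fun q => by
    rw [← hrel _ (hout q)]
    congr 1
    refine he_mk _ _ ?_
    rw [Ideal.Quotient.mk_out])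
  have hval' : ∀ c, ¬ π ∣ c → v (e c) = 1 := by
    intro c hc
    have h3 := hval ⟨Ideal.Quotient.mk (Ideal.span {π}) c, by rw [Ne, hmk0]; exact hc⟩
    rw [← h3]
    congr 1
    refine he_mk _ _ ?_
    rw [Ideal.Quotient.mk_out]
  have hlt : ∀ c, ¬ π ∣ c → v (e c ^ 2 - 1) < 1 := by
    intro c hc
    have h3 : e c ^ 2 - 1 = e c * (2 * Complex.I * e ((1 + gI) * c)) := by
      rw [hrel c hc]
      have := he0 c hc
      field_simp
    rw [h3, map_mul, map_mul, map_mul, val_I, hval' c hc, hval' _ (hnd c hc)]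
    simpa using h2
  refine ⟨-K ^ 2, by simpa using hK0, fun c hc => ⟨?_, ?_⟩⟩
  · have h3 : ellE ((c : ℂ) / π) ^ 4 / (-K ^ 2) = e c ^ 2 := by
      simp only [e]
      rw [div_pow, mul_pow, hI2]
      ring
    rw [h3]
    exact hlt c hc
  · have h4 : ellE ((c : ℂ) / π + om) = K / ellE ((c : ℂ) / π) := by
      rw [eq_div_iff (hE0 c hc), mul_comm]; exact hprod c hc
    have h6 := hE0 c hc
    have h3 : ellE ((c : ℂ) / π + om) ^ 4 / (-K ^ 2) - 1 = -((e c ^ 2)⁻¹ * (e c ^ 2 - 1)) := by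
      rw [mul_sub, inv_mul_cancel₀ (pow_ne_zero _ (he0 c hc)), h4]
      simp only [e]
      rw [div_pow, div_pow, mul_pow, hI2]
      field_simp
      ring
    rw [h3, Valuation.map_neg, map_mul, map_inv₀, map_pow, hval' c hc]
    simpa using hlt c hc

/-- Non-vanishing of a quartic elliptic Gauss sum. -/
theorem sum_ne_zero_of_quartic (hsg : sg π = -1)
    [Fintype (GaussianInt ⧸ Ideal.span {π})]
    (hcard : Fintype.card (GaussianInt ⧸ Ideal.span {π}) % 8 = 5)
    {Γ₀ : Type*} [LinearOrderedCommGroupWithZero Γ₀] (v : Valuation ℂ Γ₀) (h2 : v 2 < 1)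
    {X e : GaussianInt → ℂ} {j A : ℂ} (hj : j = Complex.I ∨ j = -Complex.I) (hA : A ≠ 0)
    (hX0 : ∀ a, π ∣ a → X a = 0) (hX4 : ∀ a, ¬ π ∣ a → X a ^ 4 = 1)
    (hXper : ∀ a k, X (a + π * k) = X a) (hXI : ∀ a, X (gI * a) = j * X a)
    (heper : ∀ a k, e (a + π * k) = sg k * e a) (heI : ∀ a, j * e (gI * a) = e a)
    (hev : ∀ a, ¬ π ∣ a → v (e a ^ 4 / A - 1) < 1) :
    ∑ q : GaussianInt ⧸ Ideal.span {π}, X q.out * sg q.out * e q.out ≠ 0 := by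
  classical
  set mk := Ideal.Quotient.mk (Ideal.span {π}) with hmk
  have hmk0 : ∀ c : GaussianInt, mk c = 0 ↔ π ∣ c := fun c => by
    rw [Ideal.Quotient.eq_zero_iff_mem, Ideal.mem_span_singleton]
  have hdec : ∀ c : GaussianInt, ∃ k, (mk c).out = c + π * k := by
    intro c
    have h : mk (mk c).out = mk c := Ideal.Quotient.mk_out _
    rw [Ideal.Quotient.eq, Ideal.mem_span_singleton] at h
    obtain ⟨k, hk⟩ := h
    exact ⟨k, by rw [← hk]; ring⟩
  let x : GaussianInt ⧸ Ideal.span {π} → ℂ := fun q => X q.out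
  let f : GaussianInt ⧸ Ideal.span {π} → ℂ := fun q => X q.out * sg q.out * e q.out
  have hxmk : ∀ c, x (mk c) = X c := by
    intro c
    obtain ⟨k, hk⟩ := hdec c
    simp only [x, hk, hXper]
  have hfmk : ∀ c, f (mk c) = X c * sg c * e c := by
    intro c
    obtain ⟨k, hk⟩ := hdec c
    simp only [f, hk, hXper, heper, sg_add, sg_mul_of_sg_eq hsg]
    linear_combination X c * sg c * e c * sg_sq k
  have hout : ∀ q : GaussianInt ⧸ Ideal.span {π}, mk q.out = q := Ideal.Quotient.mk_out
  have hdvd : ∀ q : GaussianInt ⧸ Ideal.span {π}, π ∣ q.out ↔ q = 0 := by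
    intro q
    rw [← hmk0, hout]
  have hgI : mk gI * mk (-gI) = 1 := by
    rw [← map_mul, mul_neg, gI_mul_gI, neg_neg, map_one]
  let σ : Equiv.Perm (GaussianInt ⧸ Ideal.span {π}) :=
    ⟨fun q => mk gI * q, fun q => mk (-gI) * q,
      fun q => by simp only [← mul_assoc, mul_comm (mk (-gI)) (mk gI), hgI, one_mul],
      fun q => by simp only [← mul_assoc, hgI, one_mul]⟩
  have hσ : ∀ q, σ q = mk (gI * q.out) := by
    intro q
    rw [map_mul, hout]
    rfl
  have hxσ : ∀ q, x (σ q) = j * x q := by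
    intro q
    rw [hσ, hxmk, hXI]
  have hfσ : ∀ q, f (σ q) = f q := by
    intro q
    rw [hσ, hfmk, hXI, sg_gI_mul]
    simp only [f]
    rw [← heI q.out]
    ring
  have hx4 : ∀ q, x q ^ 4 ≠ 1 → q = 0 := by
    intro q hq
    by_contra h
    exact hq (hX4 _ ((hdvd q).not.mpr h))
  have hsum := sum_eq_four_mul_sum_filter σ hj hxσ hfσ (fun q hq => by
    simp only [f]
    rw [hX0 _ ((hdvd q).mpr (hx4 q hq)), zero_mul, zero_mul])
  have hx0 : ∀ q, x q = 1 → q ≠ 0 := by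
    intro q hq h
    have : x q = 0 := hX0 _ ((hdvd q).mpr h)
    rw [hq] at this
    exact one_ne_zero this
  have hodd : Odd (Finset.univ.filter fun q => x q = 1).card := by
    have hone := sum_eq_four_mul_sum_filter σ (f := fun q => if q = 0 then 0 else 1) hj hxσ
      (fun q => by
        have : σ q = 0 ↔ q = 0 := by
          rw [hσ, hmk0, ← hdvd q]
          refine ⟨fun h => ?_, fun h => h.mul_left _⟩
          have h3 := h.mul_left (-gI)
          rwa [← mul_assoc, neg_mul, gI_mul_gI, neg_neg, one_mul] at h3
        simp only [this])
      (fun q hq => by simp [hx4 q hq])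
    have hr : ∑ q with x q = 1, (if q = 0 then (0 : ℂ) else 1) =
        (Finset.univ.filter fun q => x q = 1).card := by
      rw [Finset.sum_congr rfl (g := fun _ => (1 : ℂ)) fun q hq =>
        if_neg (hx0 q (by simpa using hq))]
      simp
    have hl : ∑ q : GaussianInt ⧸ Ideal.span {π}, (if q = 0 then (0 : ℂ) else 1) + 1 =
        Fintype.card (GaussianInt ⧸ Ideal.span {π}) := by
      have h3 : ∑ q : GaussianInt ⧸ Ideal.span {π}, (if q = 0 then (1 : ℂ) else 0) = 1 := by simp
      rw [← h3, ← Finset.sum_add_distrib]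
      rw [Finset.sum_congr rfl (g := fun _ => (1 : ℂ)) fun q _ => by split_ifs <;> simp]
      simp
    rw [hone, hr] at hl
    have h5 : 4 * (Finset.univ.filter fun q => x q = 1).card + 1 =
        Fintype.card (GaussianInt ⧸ Ideal.span {π}) := by exact_mod_cast hl
    rw [Nat.odd_iff]
    omega
  change ∑ q, f q ≠ 0
  rw [hsum]
  refine mul_ne_zero (by norm_num) (sum_ne_zero_of_val v h2 hodd hA fun q hq => ?_)
  have hq0 : ¬ π ∣ q.out := (hdvd q).not.mpr (hx0 q (by simpa using hq))
  have h4 : f q ^ 4 = e q.out ^ 4 := by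
    simp only [f]
    rw [mul_pow, mul_pow, hX4 _ hq0, show sg q.out ^ 4 = (sg q.out * sg q.out) ^ 2 by ring, sg_sq]
    ring
  rw [h4]
  exact hev _ hq0

end Division

lemma prime_of_norm_prime {π : GaussianInt} {p : ℕ} (hp : p.Prime) (hn : π.norm = p) :
    Prime π := by
  have hnat : π.norm.natAbs = p := by rw [hn]; rfl
  refine Irreducible.prime ⟨fun h => ?_, fun {a b} hab => ?_⟩
  · rw [← Zsqrtd.norm_eq_one_iff, hnat] at h
    exact hp.one_lt.ne' h
  · rw [hab, Zsqrtd.norm_mul, Int.natAbs_mul] at hnat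
    rw [← Zsqrtd.norm_eq_one_iff, ← Zsqrtd.norm_eq_one_iff]
    rcases (Nat.dvd_prime hp).mp (Dvd.intro _ hnat) with h | h
    · exact Or.inl h
    · right
      rw [h] at hnat
      exact Nat.eq_of_mul_eq_mul_left hp.pos (by rw [hnat, mul_one])

lemma coe_norm_dvd {π : GaussianInt} {n : ℤ} (h : π ∣ (n : GaussianInt)) : π.norm ∣ n ^ 2 := by
  obtain ⟨k, hk⟩ := h
  refine ⟨k.norm, ?_⟩
  rw [← Zsqrtd.norm_mul, ← hk, Zsqrtd.norm_intCast, pow_two]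

lemma dvd_coe_norm (π : GaussianInt) : π ∣ ((π.norm : ℤ) : GaussianInt) :=
  ⟨star π, by rw [Zsqrtd.norm_eq_mul_conj]⟩

lemma natCard_quotient {π : GaussianInt} {p : ℕ} (hp : p.Prime) (hn : π.norm = p) :
    Nat.card (GaussianInt ⧸ Ideal.span {π}) = p := by
  let f : ℤ →+* GaussianInt ⧸ Ideal.span {π} := Int.castRingHom _
  have hf : ∀ n : ℤ, f n = Ideal.Quotient.mk (Ideal.span {π}) (n : GaussianInt) := fun n => by
    simp [f]
  have hpp : Prime (p : ℤ) := Nat.prime_iff_prime_int.mp hp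
  have hker : RingHom.ker f = Ideal.span {(p : ℤ)} := by
    ext n
    rw [RingHom.mem_ker, hf, Ideal.Quotient.eq_zero_iff_mem, Ideal.mem_span_singleton,
      Ideal.mem_span_singleton]
    constructor
    · intro h
      have h1 := coe_norm_dvd h
      rw [hn] at h1
      exact hpp.dvd_of_dvd_pow h1
    · rintro ⟨k, rfl⟩
      have h1 := dvd_coe_norm π
      rw [hn] at h1
      rw [Int.cast_mul]
      exact h1.mul_right _
  have hnorm : π.re * π.re + π.im * π.im = p := by
    rw [← hn, Zsqrtd.norm_def]; ring
  have him : ¬ (p : ℤ) ∣ π.im := by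
    intro h
    have h1 : (p : ℤ) ∣ π.re * π.re := by
      have : π.re * π.re = p - π.im * π.im := by linarith
      rw [this]
      exact dvd_sub dvd_rfl (h.mul_right _)
    have h2 : (p : ℤ) ∣ π.re := (hpp.dvd_or_dvd h1).elim id id
    obtain ⟨a, ha⟩ := h
    obtain ⟨b, hb⟩ := h2
    rw [ha, hb] at hnorm
    have h3 : (p : ℤ) * (p * (b * b + a * a) - 1) = 0 := by linarith
    rcases mul_eq_zero.mp h3 with h | h
    · exact hpp.ne_zero h
    · exact hpp.not_isUnit (isUnit_of_dvd_one ⟨b * b + a * a, by linarith⟩)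
  obtain ⟨u, w, huw⟩ := (Irreducible.coprime_iff_not_dvd hpp.irreducible).mpr him
  have hsurj : Function.Surjective f := by
    intro q
    obtain ⟨z, rfl⟩ := Ideal.Quotient.mk_surjective q
    refine ⟨z.re - w * π.re * z.im, ?_⟩
    rw [hf, Ideal.Quotient.eq, Ideal.mem_span_singleton]
    have hpd := dvd_coe_norm π
    rw [hn] at hpd
    have h1 : ((z.re - w * π.re * z.im : ℤ) : GaussianInt) - z =
        -(π * (w * z.im)) - ((p : ℤ) : GaussianInt) * (u * z.im * gI) := by
      ext
      · simp [gI]; ring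
      · simp [gI]; linear_combination z.im * huw
    rw [h1]
    exact dvd_sub (dvd_neg.mpr (Dvd.intro _ rfl)) (hpd.mul_right _)
  have e1 := RingHom.quotientKerEquivOfSurjective hsurj
  have e0 := Ideal.quotEquivOfEq hker
  have e2 := Int.quotientSpanEquivZMod (p : ℤ)
  rw [← Nat.card_congr e1.toEquiv, Nat.card_congr e0.toEquiv, Nat.card_congr e2.toEquiv]
  simp

lemma mem_O4_iff {z : ℂ} : z ∈ O4 ↔ ∃ a : GaussianInt, (a : ℂ) = z := by
  have h : O4 = GaussianInt.toComplex.range := by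
    refine le_antisymm (Subring.closure_le.mpr ?_) ?_
    · rintro _ rfl
      exact ⟨gI, coe_gI⟩
    · rintro _ ⟨a, rfl⟩
      have hI : Complex.I ∈ O4 := Subring.subset_closure rfl
      rw [GaussianInt.toComplex_def]
      exact add_mem (intCast_mem _ _) (mul_mem (intCast_mem _ _) hI)
  rw [h]
  rfl

lemma coe_mem_O4 (a : GaussianInt) : (a : ℂ) ∈ O4 := mem_O4_iff.mpr ⟨a, rfl⟩

/-- The identification of the two models of `ℤ[i]`. -/
def equivO4 : GaussianInt ≃ O4 :=
  Equiv.ofBijective (fun a => ⟨(a : ℂ), coe_mem_O4 a⟩)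
    ⟨fun _ _ h => GaussianInt.toComplex_inj.mp (congrArg Subtype.val h),
      fun z => (mem_O4_iff.mp z.2).imp fun _ h => Subtype.ext h⟩

lemma tsum_O4 (χ : ℂ → ℂ) (s : ℂ) :
    ∑' ν : O4, χ (ν : ℂ) * (starRingEnd ℂ) (ν : ℂ) * ((Complex.normSq (ν : ℂ) : ℂ) ^ (-s)) =
      ∑' a : GaussianInt, χ a * heckeTerm s a := by
  rw [← equivO4.tsum_eq]
  refine tsum_congr fun a => ?_
  rw [heckeTerm, ← mul_assoc]
  rfl

lemma gCong_coe_iff {a b c : GaussianInt} : GCong a b c ↔ c ∣ a - b := by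
  constructor
  · rintro ⟨d, hd, h⟩
    obtain ⟨d, rfl⟩ := mem_O4_iff.mp hd
    refine ⟨d, ?_⟩
    rw [← GaussianInt.toComplex_inj, GaussianInt.toComplex_sub, GaussianInt.toComplex_mul, h]
  · rintro ⟨d, h⟩
    refine ⟨d, coe_mem_O4 d, ?_⟩
    rw [← GaussianInt.toComplex_sub, ← GaussianInt.toComplex_mul, h]

lemma gCoprime_coe_iff {a b : GaussianInt} : GCoprime a b ↔ IsCoprime a b := by
  constructor
  · rintro ⟨u, hu, v, hv, h⟩
    obtain ⟨u, rfl⟩ := mem_O4_iff.mp hu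
    obtain ⟨v, rfl⟩ := mem_O4_iff.mp hv
    refine ⟨u, v, ?_⟩
    rw [← GaussianInt.toComplex_inj]
    simpa using h
  · rintro ⟨u, v, h⟩
    refine ⟨u, coe_mem_O4 u, v, coe_mem_O4 v, ?_⟩
    rw [← GaussianInt.toComplex_inj] at h
    simpa using h

lemma sg_one_add_gI_mul (k : GaussianInt) : sg ((1 + gI) * k) = 1 := by
  rw [add_mul, one_mul, sg_add, sg_gI_mul, sg_sq]

lemma exists_of_sg_eq_one {a : GaussianInt} (h : sg a = 1) : ∃ k, (1 + gI) * k = a := by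
  have heven : Even (a.re + a.im) := by
    rcases Int.even_or_odd (a.re + a.im) with h' | h'
    · exact h'
    · rw [sg, h'.neg_one_zpow] at h; norm_num at h
  obtain ⟨m, hm⟩ := heven
  refine ⟨⟨m, a.im - m⟩, ?_⟩
  ext
  · simp [gI]; linarith
  · simp [gI]

lemma one_add_gI_mul_injective : Function.Injective fun k : GaussianInt => (1 + gI) * k := by
  refine mul_right_injective₀ ?_
  intro h
  have := congrArg Zsqrtd.re h
  simp [gI] at this

lemma chi0'_of_sg_eq_one {χ₀' : ℂ → ℂ} (h : IsChi0'₄ χ₀') {a : GaussianInt} (ha : sg a = 1) :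
    χ₀' a = 0 := by
  refine h.1.vanish _ (coe_mem_O4 a) ?_
  have h2 : (2 : ℂ) = ((2 : GaussianInt) : ℂ) := (map_ofNat GaussianInt.toComplex 2).symm
  rw [h2, gCoprime_coe_iff]
  rintro ⟨u, w, huw⟩
  obtain ⟨k, rfl⟩ := exists_of_sg_eq_one ha
  have h1 : (1 : GaussianInt) = (1 + gI) * (u * k + w * (1 - gI)) := by
    linear_combination w * gI_mul_gI - huw
  have h3 : sg (1 + gI) = 1 := by
    have := sg_one_add_gI_mul 1
    rwa [mul_one] at this
  have h4 := sg_one_add_gI_mul (u * k + w * (1 - gI))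
  rw [← h1, sg_one] at h4
  norm_num at h4

lemma chi0'_add {χ₀' : ℂ → ℂ} (h : IsChi0'₄ χ₀') {π : GaussianInt} (hπ : 2 ∣ π - 1)
    (μ : GaussianInt) : χ₀' ((π + (1 + gI) * μ : GaussianInt) : ℂ) = sg μ := by
  have key : ∀ a b : GaussianInt, 2 ∣ a - b → χ₀' a = χ₀' b := fun a b hab => by
    refine h.1.periodic _ (coe_mem_O4 a) _ (coe_mem_O4 b) ?_
    have h2 : (2 : ℂ) = ((2 : GaussianInt) : ℂ) := (map_ofNat GaussianInt.toComplex 2).symm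
    rw [h2, gCong_coe_iff]
    exact hab
  obtain ⟨d, hd⟩ := hπ
  rcases eq_or_ne (sg μ) 1 with hμ | hμ
  · obtain ⟨k, rfl⟩ := exists_of_sg_eq_one hμ
    rw [hμ, key _ 1 ⟨d + gI * k, by linear_combination hd + k * gI_mul_gI⟩]
    simpa using h.1.map_one
  · have hμ' : sg μ = -1 := (mul_self_eq_one_iff.mp (sg_sq μ)).resolve_left hμ
    have h1 : sg (μ - 1) = 1 := by
      rw [sub_eq_add_neg, sg_add, hμ', sg_neg, sg_one]; norm_num
    obtain ⟨k, hk⟩ := exists_of_sg_eq_one h1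
    rw [hμ', key _ gI ⟨d + 1 + gI * k, by
      linear_combination hd - (1 + gI) * hk + k * gI_mul_gI⟩, coe_gI]
    exact h.2

section QuarticCharacter

variable {π : GaussianInt} {p : ℕ} {χ : ℂ → ℂ}

lemma five_le_of_mod_eight {p : ℕ} (hp8 : p % 8 = 5) : 5 ≤ p := by omega

lemma not_dvd_one_add_gI (hn : π.norm = p) (hp8 : p % 8 = 5) : ¬ π ∣ 1 + gI := by
  rintro ⟨k, hk⟩
  have h1 := congrArg Zsqrtd.norm hk
  have h2 : (1 + gI : GaussianInt).norm = 2 := by simp [gI, Zsqrtd.norm_def]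
  rw [h2, Zsqrtd.norm_mul, hn] at h1
  have h3 : (p : ℤ) ≤ 2 := Int.le_of_dvd (by norm_num) ⟨_, h1⟩
  omega

lemma quartic_eq_zero (hχ : IsQuarticChar π p χ) (hπ : Prime π) {a : GaussianInt} (ha : π ∣ a) :
    χ a = 0 := by
  refine hχ.resChar.vanish _ (coe_mem_O4 a) ?_
  rw [gCoprime_coe_iff]
  exact fun h => hπ.not_isUnit (h.isUnit_of_dvd' ha dvd_rfl)

lemma quartic_coprime (hπ : Prime π) {a : GaussianInt} (ha : ¬ π ∣ a) : GCoprime a π := by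
  rw [gCoprime_coe_iff]
  exact ((Irreducible.coprime_iff_not_dvd hπ.irreducible).mpr ha).symm

lemma quartic_pow_four (hχ : IsQuarticChar π p χ) (hπ : Prime π) {a : GaussianInt}
    (ha : ¬ π ∣ a) : χ a ^ 4 = 1 :=
  hχ.quart _ (coe_mem_O4 a) (quartic_coprime hπ ha)

lemma quartic_periodic (hχ : IsQuarticChar π p χ) (a k : GaussianInt) :
    χ ((a + π * k : GaussianInt) : ℂ) = χ a :=
  hχ.resChar.periodic _ (coe_mem_O4 _) _ (coe_mem_O4 _)
    (gCong_coe_iff.mpr ⟨k, by ring⟩)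

lemma quartic_mul (hχ : IsQuarticChar π p χ) (a b : GaussianInt) :
    χ ((a * b : GaussianInt) : ℂ) = χ a * χ b := by
  rw [GaussianInt.toComplex_mul]
  exact hχ.resChar.map_mul _ (coe_mem_O4 a) _ (coe_mem_O4 b)

lemma norm_quartic_le (hχ : IsQuarticChar π p χ) (hπ : Prime π) (a : GaussianInt) :
    ‖χ a‖ ≤ 1 := by
  by_cases ha : π ∣ a
  · rw [quartic_eq_zero hχ hπ ha, norm_zero]
    exact zero_le_one
  · have h := congrArg norm (quartic_pow_four hχ hπ ha)
    rw [norm_pow, norm_one] at h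
    exact ((pow_eq_one_iff_of_nonneg (norm_nonneg _) (by norm_num)).mp h).le

lemma quartic_gI (hχ : IsQuarticChar π p χ) (hπ : Prime π) (hn : π.norm = p)
    (hp8 : p % 8 = 5) : χ gI = Complex.I ^ ((p - 1) / 4) := by
  have hI : ¬ π ∣ gI := fun h => hπ.not_isUnit
    (isUnit_of_dvd_unit h (IsUnit.of_mul_eq_one (-gI) (by rw [mul_neg, gI_mul_gI, neg_neg])))
  obtain ⟨d, hd, h⟩ := hχ.euler _ (coe_mem_O4 gI) (quartic_coprime hπ hI)
  obtain ⟨d, rfl⟩ := mem_O4_iff.mp hd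
  rw [coe_gI] at h ⊢
  by_contra hne
  have hd0 : d ≠ 0 := by
    rintro rfl
    rw [GaussianInt.toComplex_zero, mul_zero] at h
    exact hne (sub_eq_zero.mp h)
  have h1 : ‖χ Complex.I‖ ≤ 1 := by
    have := norm_quartic_le hχ hπ gI
    rwa [coe_gI] at this
  have h2 : ‖(π : ℂ) * d‖ ≤ 2 := by
    rw [← h]
    refine (norm_sub_le _ _).trans ?_
    rw [norm_pow, Complex.norm_I, one_pow]
    linarith
  have h3 : 1 ≤ d.norm := by
    have := GaussianInt.norm_pos.mpr hd0
    omega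
  have h4 : ‖(π : ℂ) * d‖ ^ 2 = p * (d.norm : ℝ) := by
    rw [← Complex.normSq_eq_norm_sq, Complex.normSq_mul, ← GaussianInt.intCast_real_norm,
      ← GaussianInt.intCast_real_norm, hn]
    norm_cast
  have h5 : (5 : ℝ) ≤ p := by exact_mod_cast five_le_of_mod_eight hp8
  have h6 : (1 : ℝ) ≤ d.norm := by exact_mod_cast h3
  nlinarith [norm_nonneg ((π : ℂ) * d)]

lemma quartic_gI_of_five (hχ : IsQuarticChar π p χ) (hπ : Prime π) (hn : π.norm = p)
    (hp16 : p % 16 = 5) : χ gI = Complex.I := by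
  rw [quartic_gI hχ hπ hn (by omega)]
  obtain ⟨m, hm⟩ : ∃ m, (p - 1) / 4 = 4 * m + 1 := ⟨p / 16, by omega⟩
  rw [hm, pow_succ, pow_mul, Complex.I_pow_four, one_pow, one_mul]

lemma quartic_gI_of_thirteen (hχ : IsQuarticChar π p χ) (hπ : Prime π) (hn : π.norm = p)
    (hp16 : p % 16 = 13) : χ gI = -Complex.I := by
  rw [quartic_gI hχ hπ hn (by omega)]
  obtain ⟨m, hm⟩ : ∃ m, (p - 1) / 4 = 4 * m + 3 := ⟨p / 16, by omega⟩
  rw [hm, pow_add, pow_mul, Complex.I_pow_four, one_pow, one_mul, Complex.I_pow_three]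

/-- Nonvanishing at `s = 1` of a function proportional to the Hecke series
`∑ χ(k)·(-1)^{Re k + Im k}·conj(ρ + k)·|ρ + k|^{-2s}`. -/
theorem value_at_one_ne_zero (hχ : IsQuarticChar π p χ) (hp : p.Prime) (hn : π.norm = p)
    (hp8 : p % 8 = 5) (hsg : sg π = -1)
    {F c d : ℂ → ℂ} (hF : DifferentiableOn ℂ F {s : ℂ | 0 < s.re})
    (hc : Differentiable ℂ c) (hd : Differentiable ℂ d) (hd1 : d 1 ≠ 0) (ρ : ℂ)
    (h : ∀ s : ℂ, 3 / 2 < s.re →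
      F s * c s = d s * ∑' k : GaussianInt, (χ k * sg k) * heckeTerm s (ρ + k))
    {j : ℂ} (hj : j = Complex.I ∨ j = -Complex.I) (hgI : χ gI = j)
    (heper : ∀ a k : GaussianInt,
      ellE ((ρ + (a + π * k : GaussianInt)) / π) = sg k * ellE ((ρ + a) / π))
    (heI : ∀ a : GaussianInt,
      j * ellE ((ρ + (gI * a : GaussianInt)) / π) = ellE ((ρ + a) / π))
    (hev : ∀ V : ValuationSubring ℂ, V.valuation 2 < 1 → ∃ A : ℂ, A ≠ 0 ∧
      ∀ a : GaussianInt, ¬ π ∣ a → V.valuation (ellE ((ρ + a) / π) ^ 4 / A - 1) < 1) :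
    F 1 ≠ 0 := by
  intro hF1
  have hπ := prime_of_norm_prime hp hn
  have hcard := natCard_quotient hp hn
  have : Finite (GaussianInt ⧸ Ideal.span {π}) :=
    Nat.finite_of_card_ne_zero (by rw [hcard]; exact hp.ne_zero)
  let _ := Fintype.ofFinite (GaussianInt ⧸ Ideal.span {π})
  have hbound : ∀ k : GaussianInt, ‖χ k * sg k‖ ≤ 1 := fun k => by
    rw [norm_mul, norm_sg, mul_one]
    exact norm_quartic_le hχ hπ k
  have key := continuation_at_one hF hc hd ρ π hbound
    (fun k => by
      have := quartic_periodic hχ k 1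
      rw [mul_one] at this
      rw [this, sg_add, hsg]; ring)
    (fun k => by
      rw [mul_comm gI π, quartic_periodic hχ, sg_add, mul_comm π gI, sg_gI_mul, hsg]; ring) h
  rw [tsum_lap_inv_eq hπ.ne_zero hsg ρ (norm_quartic_le hχ hπ) (quartic_periodic hχ), hF1,
    zero_mul] at key
  obtain ⟨V, hV⟩ := exists_valuationSubring_two
  obtain ⟨A, hA, hA'⟩ := hev V hV
  refine sum_ne_zero_of_quartic hsg (by rw [← Nat.card_eq_fintype_card, hcard, hp8])
    V.valuation hV hj hA (fun a => quartic_eq_zero hχ hπ) (fun a => quartic_pow_four hχ hπ)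
    (quartic_periodic hχ) (fun a => by rw [quartic_mul hχ, hgI]) heper heI hA' ?_
  have hπ0 : (π : ℂ) ≠ 0 := by
    rw [Ne, GaussianInt.toComplex_eq_zero]
    exact hπ.ne_zero
  simpa [hd1, hπ0] using key.symm

lemma tsum_quartic_eq (hχ : IsQuarticChar π p χ) (hπ : Prime π) {s : ℂ} (hs : 3 / 2 < s.re) :
    ∑' k : GaussianInt, (χ k * sg k) * heckeTerm s k =
      (2 * χ ((1 + gI : GaussianInt) : ℂ) * heckeTerm s (1 + Complex.I) - 1) *
        ∑' k : GaussianInt, χ k * heckeTerm s k := by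
  have hs1 : Summable fun k : GaussianInt => χ k * heckeTerm s k := by
    simpa using summable_heckeTerm hs 0 (norm_quartic_le hχ hπ)
  have hs2 : Summable fun k : GaussianInt => (χ k * sg k) * heckeTerm s k := by
    simpa using summable_heckeTerm hs 0 (ϕ := fun k => χ k * sg k) fun k => by
      rw [norm_mul, norm_sg, mul_one]
      exact norm_quartic_le hχ hπ k
  have h1 : ∑' k : GaussianInt, ((χ k * sg k) * heckeTerm s k + χ k * heckeTerm s k) =
      ∑' k : GaussianInt, 2 * χ ((1 + gI : GaussianInt) : ℂ) * heckeTerm s (1 + Complex.I) *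
        (χ k * heckeTerm s k) := by
    rw [← one_add_gI_mul_injective.tsum_eq]
    · refine tsum_congr fun k => ?_
      rw [sg_one_add_gI_mul, quartic_mul hχ, GaussianInt.toComplex_mul, heckeTerm_mul,
        GaussianInt.toComplex_add 1 gI, GaussianInt.toComplex_one, coe_gI]
      ring
    · intro a ha
      by_contra hna
      have h2 : sg a ≠ 1 := fun h => hna (exists_of_sg_eq_one h)
      have h3 := (mul_self_eq_one_iff.mp (sg_sq a)).resolve_left h2
      apply ha
      dsimp only
      rw [h3]; ring
  rw [hs2.tsum_add hs1, tsum_mul_left] at h1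
  linear_combination h1

lemma tsum_quartic_mul_chi0' (hχ : IsQuarticChar π p χ) (h2 : 2 ∣ π - 1) (hsg : sg π = -1)
    {χ₀' : ℂ → ℂ} (hχ₀' : IsChi0'₄ χ₀') (s : ℂ) :
    ∑' k : GaussianInt, (χ k * χ₀' k) * heckeTerm s k =
      χ ((1 + gI : GaussianInt) : ℂ) * heckeTerm s (1 + Complex.I) *
        ∑' k : GaussianInt, (χ k * sg k) * heckeTerm s (π * om + k) := by
  rw [← ((add_right_injective π).comp one_add_gI_mul_injective).tsum_eq, ← tsum_mul_left]
  · refine tsum_congr fun k => ?_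
    have h3 : ((π + (1 + gI) * k : GaussianInt) : ℂ) = (1 + Complex.I) * (π * om + k) := by
      rw [GaussianInt.toComplex_add, GaussianInt.toComplex_mul, GaussianInt.toComplex_add 1 gI,
        GaussianInt.toComplex_one, coe_gI]
      linear_combination (-(π : ℂ)) * one_add_I_mul_om
    have h4 : χ ((π + (1 + gI) * k : GaussianInt) : ℂ) =
        χ ((1 + gI : GaussianInt) : ℂ) * χ k := by
      rw [← quartic_mul hχ, ← quartic_periodic hχ ((1 + gI) * k) 1, mul_one, add_comm]
    dsimp only [Function.comp]
    rw [h4, chi0'_add hχ₀' h2, h3, heckeTerm_mul]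
    ring
  · intro a ha
    have h5 : sg a ≠ 1 := fun h => ha (by dsimp only; rw [chi0'_of_sg_eq_one hχ₀' h]; ring)
    have h6 := (mul_self_eq_one_iff.mp (sg_sq a)).resolve_left h5
    obtain ⟨k, hk⟩ := exists_of_sg_eq_one (a := a - π) (by
      rw [sub_eq_add_neg, sg_add, sg_neg, h6, hsg]; norm_num)
    exact ⟨k, by dsimp only [Function.comp]; rw [hk]; ring⟩

theorem value_ne_zero_of_five (hχ : IsQuarticChar π p χ) (hp : p.Prime) (hn : π.norm = p)
    (hp16 : p % 16 = 5) (hsg : sg π = -1) {L : ℂ} (hL : IsLValue4 χ L) : L ≠ 0 := by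
  obtain ⟨F, hF, hFs, rfl⟩ := hL
  have hp8 : p % 8 = 5 := by omega
  have hπ := prime_of_norm_prime hp hn
  refine value_at_one_ne_zero hχ hp hn hp8 hsg hF
    (c := fun s => 2 * χ ((1 + gI : GaussianInt) : ℂ) * heckeTerm s (1 + Complex.I) - 1)
    (d := fun _ => 1 / 4) (((differentiable_heckeTerm _).const_mul _).sub_const _)
    (differentiable_const _) (by norm_num) 0 (fun s hs => ?_) (Or.inl rfl)
    (quartic_gI_of_five hχ hπ hn hp16) (fun a k => ?_) (fun a => ?_) (fun V hV => ?_)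
  · simp only [zero_add]
    rw [hFs s hs, tsum_O4, tsum_quartic_eq hχ hπ hs]
    ring
  · have := ellE_div_add hπ.ne_zero a k 0
    simpa using this
  · rw [zero_add, zero_add, GaussianInt.toComplex_mul, coe_gI, mul_div_assoc, ellE_I_mul]
    linear_combination (-ellE ((a : ℂ) / π)) * Complex.I_mul_I
  · have : Finite (GaussianInt ⧸ Ideal.span {π}) :=
      Nat.finite_of_card_ne_zero (by rw [natCard_quotient hp hn]; exact hp.ne_zero)
    obtain ⟨A, hA, h⟩ := exists_val_ellE_div V.valuation hV hπ (not_dvd_one_add_gI hn hp8)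
    exact ⟨A, hA, fun a ha => by rw [zero_add]; exact (h a ha).1⟩

theorem value_ne_zero_of_thirteen (hχ : IsQuarticChar π p χ) (hp : p.Prime) (hn : π.norm = p)
    (hp16 : p % 16 = 13) (h2 : 2 ∣ π - 1) (hsg : sg π = -1) {χ₀' : ℂ → ℂ}
    (hχ₀' : IsChi0'₄ χ₀') {L : ℂ} (hL : IsLValue4 (fun ν => χ ν * χ₀' ν) L) : L ≠ 0 := by
  obtain ⟨F, hF, hFs, rfl⟩ := hL
  have hp8 : p % 8 = 5 := by omega
  have hπ := prime_of_norm_prime hp hn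
  have hdvd := not_dvd_one_add_gI hn hp8
  have hπ0 : (π : ℂ) ≠ 0 := by
    rw [Ne, GaussianInt.toComplex_eq_zero]
    exact hπ.ne_zero
  have hdiv : ∀ a : GaussianInt, ((π : ℂ) * om + a) / π = (a : ℂ) / π + om := fun a => by
    field_simp
    ring
  refine value_at_one_ne_zero hχ hp hn hp8 hsg hF (c := fun _ => 1)
    (d := fun s => 1 / 4 * χ ((1 + gI : GaussianInt) : ℂ) * heckeTerm s (1 + Complex.I))
    (differentiable_const _) ((differentiable_heckeTerm _).const_mul _) ?_ (π * om)
    (fun s hs => ?_) (Or.inr rfl)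
    (quartic_gI_of_thirteen hχ hπ hn hp16) (fun a k => ?_) (fun a => ?_) (fun V hV => ?_)
  · have h4 := quartic_pow_four hχ hπ hdvd
    have h5 : χ ((1 + gI : GaussianInt) : ℂ) ≠ 0 := fun h => by
      rw [h] at h4
      norm_num at h4
    rw [heckeTerm_one_left]
    exact mul_ne_zero (mul_ne_zero (by norm_num) h5) (inv_ne_zero one_add_I_ne)
  · rw [hFs s hs, tsum_O4 (fun ν => χ ν * χ₀' ν), tsum_quartic_mul_chi0' hχ h2 hsg hχ₀']
    ring
  · rw [hdiv, hdiv]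
    exact ellE_div_add hπ.ne_zero a k om
  · have h6 : ((gI * a : GaussianInt) : ℂ) / π + om + gI = Complex.I * ((a : ℂ) / π + om) := by
      rw [GaussianInt.toComplex_mul, coe_gI, om_eq]
      linear_combination (1 / 2 : ℂ) * Complex.I_mul_I
    have h7 := ellE_add (((gI * a : GaussianInt) : ℂ) / π + om) gI
    rw [h6, ellE_I_mul, sg_gI] at h7
    rw [hdiv, hdiv]
    linear_combination (-Complex.I) * h7 - ellE ((a : ℂ) / π + om) * Complex.I_mul_I
  · have : Finite (GaussianInt ⧸ Ideal.span {π}) :=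
      Nat.finite_of_card_ne_zero (by rw [natCard_quotient hp hn]; exact hp.ne_zero)
    obtain ⟨A, hA, h⟩ := exists_val_ellE_div V.valuation hV hπ hdvd
    exact ⟨A, hA, fun a ha => by rw [hdiv]; exact (h a ha).2⟩

end QuarticCharacter

end GaussHecke

/-- **Corollary II.3.** Let `π ∈ ℤ[i]` be a primary prime with `p = π·π̄` and let
`χ̃_π` be the associated Hecke character of weight one. If `p ≡ 5 (mod 8)`, then
`L(1, χ̃_π) ≠ 0`. -/
theorem stmt_17
    (p : ℕ) (hp : p.Prime) (hp8 : p % 8 = 5)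
    (π : ℂ) (hπ : π ∈ O4) (hprimary : GCong π 1 ((1 + Complex.I) ^ 3))
    (hnorm : (p : ℂ) = π * (starRingEnd ℂ) π)
    (χ : ℂ → ℂ) (hχ : IsQuarticChar π p χ)
    (χ₀' : ℂ → ℂ) (hχ₀' : IsChi0'₄ χ₀') :
    (p % 16 = 13 → ∀ L : ℂ, IsLValue4 (fun ν => χ ν * χ₀' ν) L → L ≠ 0) ∧
    (p % 16 = 5 → ∀ L : ℂ, IsLValue4 χ L → L ≠ 0) := by
  obtain ⟨π, rfl⟩ := GaussHecke.mem_O4_iff.mp hπ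
  have hn : π.norm = p := by
    rw [Complex.mul_conj, ← GaussianInt.intCast_complex_norm] at hnorm
    exact_mod_cast hnorm.symm
  obtain ⟨d, hd⟩ : (1 + GaussHecke.gI) ^ 3 ∣ π - 1 := by
    rw [← GaussHecke.gCong_coe_iff]
    simpa [GaussHecke.coe_gI] using hprimary
  have h2 : 2 ∣ π - 1 := ⟨(GaussHecke.gI - 1) * d, by
    rw [hd]
    linear_combination (GaussHecke.gI + 3) * d * GaussHecke.gI_mul_gI⟩
  have hsg : GaussHecke.sg π = -1 := by
    have h3 : π = 1 + (1 + GaussHecke.gI) * ((1 + GaussHecke.gI) ^ 2 * d) := by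
      linear_combination hd
    rw [h3, GaussHecke.sg_add, GaussHecke.sg_one, GaussHecke.sg_one_add_gI_mul, mul_one]
  exact ⟨fun h _ hL => GaussHecke.value_ne_zero_of_thirteen hχ hp hn h h2 hsg hχ₀' hL,
    fun h _ hL => GaussHecke.value_ne_zero_of_five hχ hp hn h hsg hL⟩

end
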